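/- arXiv:1405.4661 — 2 statements merged into one kernel-verified Lean document; each statement's English description precedes it below -/
import Mathlib

section
/- Let n > 10 be an integer, p > p_c, α > 0, b > 0 and γ ∈ (ν+λ₁, (n−2)/2). Suppose v₀ : ℝⁿ → ℝ is continuous and v₀(x) ≥ φ_α(|x|) + b(|x|+1)^{−γ} for all x ∈ ℝⁿ. Then for every bounded classical solution v of (v^p)_t = Δv + v^p on ℝⁿ with initial data v₀ there exists C > 0 such that v(0,t) − φ_α(0) ≥ C e^{−κ(γ) t} for all t ≥ 0. -/
noncomputable section

open Real Filter Set Asymptotics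

/-- `ν = 2/(p-1)`. -/
def nuExp (p : ℝ) : ℝ := 2 / (p - 1)

/-- `L = (ν(n−2−ν))^{1/(p−1)}`. -/
def Lconst (n : ℕ) (p : ℝ) : ℝ := (nuExp p * ((n : ℝ) - 2 - nuExp p)) ^ (1 / (p - 1))

/-- The critical exponent `p_c` for `n > 10`. -/
def pc (n : ℕ) : ℝ :=
  (((n : ℝ) - 2) ^ 2 - 4 * (n : ℝ) + 8 * Real.sqrt ((n : ℝ) - 1)) /
    (((n : ℝ) - 2) * ((n : ℝ) - 10))

/-- `λ₁ = (n−2−2ν − √((n−2−2ν)² − 8(n−2−ν)))/2`. -/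
def lam1 (n : ℕ) (p : ℝ) : ℝ :=
  (((n : ℝ) - 2 - 2 * nuExp p) -
    Real.sqrt (((n : ℝ) - 2 - 2 * nuExp p) ^ 2 - 8 * ((n : ℝ) - 2 - nuExp p))) / 2

/-- `κ(γ) = γ(n−2−γ)/(pL^{p−1}) − 1`. -/
def kappaOf (n : ℕ) (p γ : ℝ) : ℝ :=
  γ * ((n : ℝ) - 2 - γ) / (p * Lconst n p ^ (p - 1)) - 1

/-- `φ` is the (radial profile of the) positive steady state `φ_α` of `Δφ + φ^p = 0`
with `φ(0) = α`, `φ'(0) = 0`, together with its properties in the supercritical range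
`n > 10`, `p > p_c`: positivity, strict monotonicity, the bound `φ(r) ≤ L r^{−ν}`, and the
asymptotic expansion `φ(r) = L r^{−ν} − a r^{−ν−λ₁} + o(r^{−ν−λ₁})` with coefficient `a > 0`. -/
structure IsSteadyStateA (n : ℕ) (p α : ℝ) (φ : ℝ → ℝ) (a : ℝ) : Prop where
  cont : ContinuousOn φ (Set.Ici 0)
  smooth : ContDiffOn ℝ 2 φ (Set.Ioi 0)
  ode : ∀ r > (0 : ℝ), deriv (deriv φ) r + ((n : ℝ) - 1) / r * deriv φ r + φ r ^ p = 0
  val0 : φ 0 = α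
  deriv0 : derivWithin φ (Set.Ici 0) 0 = 0
  pos : ∀ r ≥ (0 : ℝ), 0 < φ r
  anti : StrictAntiOn φ (Set.Ici 0)
  upper : ∀ r > (0 : ℝ), φ r ≤ Lconst n p * r ^ (-nuExp p)
  a_pos : 0 < a
  expansion :
    (fun r => φ r - (Lconst n p * r ^ (-nuExp p) - a * r ^ (-nuExp p - lam1 n p)))
      =o[atTop] fun r => r ^ (-nuExp p - lam1 n p)

/-- The Laplacian of `f : ℝⁿ → ℝ` at `x`, as the sum of second partial derivatives. -/
def lap (n : ℕ) (f : EuclideanSpace ℝ (Fin n) → ℝ) (x : EuclideanSpace ℝ (Fin n)) : ℝ :=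
  ∑ i : Fin n, fderiv ℝ (fun y => fderiv ℝ f y (EuclideanSpace.single i 1)) x
    (EuclideanSpace.single i 1)

/-- `v` is a bounded classical solution of `(v^p)_t = Δv + v^p` on `ℝⁿ × (0,∞)` with
initial data `v₀`: nonnegative, continuous on `ℝⁿ × [0,∞)`, bounded on `ℝⁿ × [0,T]` for
every `T > 0`, twice continuously differentiable in `x` and once (continuously) in `t` for
`t > 0`, satisfying the equation pointwise, and attaining the initial data. -/
structure IsBddClassicalSol (n : ℕ) (p : ℝ) (v : EuclideanSpace ℝ (Fin n) → ℝ → ℝ)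
    (v₀ : EuclideanSpace ℝ (Fin n) → ℝ) : Prop where
  nonneg : ∀ x, ∀ t ≥ (0 : ℝ), 0 ≤ v x t
  cont : ContinuousOn (fun q : EuclideanSpace ℝ (Fin n) × ℝ => v q.1 q.2)
    ((Set.univ : Set (EuclideanSpace ℝ (Fin n))) ×ˢ Set.Ici (0 : ℝ))
  bdd : ∀ T > (0 : ℝ), ∃ M, ∀ x, ∀ t ∈ Set.Icc (0 : ℝ) T, v x t ≤ M
  smooth_space : ∀ t > (0 : ℝ), ContDiff ℝ 2 fun x => v x t
  smooth_time : ∀ x, ContDiffOn ℝ 1 (fun s => v x s ^ p) (Set.Ioi (0 : ℝ))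
  pde : ∀ x, ∀ t > (0 : ℝ),
    deriv (fun s => v x s ^ p) t = lap n (fun y => v y t) x + v x t ^ p
  init : ∀ x, v x 0 = v₀ x



lemma second_deriv_nonneg_of_min (D D1 : ℝ → ℝ) (D2 : ℝ) (hmin : IsLocalMin D 0)
    (h1 : ∀ᶠ s in nhds (0:ℝ), HasDerivAt D (D1 s) s) (h2 : HasDerivAt D1 D2 0) : 0 ≤ D2 := by
  by_contra hneg
  push Not at hneg
  have e1 : deriv D =ᶠ[nhds 0] D1 := h1.mono fun s hs => hs.deriv
  have e2 : deriv (deriv D) 0 = D2 := by rw [e1.deriv_eq]; exact h2.deriv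
  have hmax : IsLocalMax D 0 := by
    apply isLocalMax_of_deriv_deriv_neg
    · rw [e2]; exact hneg
    · exact hmin.deriv_eq_zero
    · exact h1.self_of_nhds.continuousAt
  have hc : D =ᶠ[nhds 0] fun _ => D 0 := by
    filter_upwards [hmin, hmax] with s a b
    exact le_antisymm b a
  have e3 : deriv D =ᶠ[nhds 0] fun _ => 0 := by
    have := hc.deriv
    simpa using this
  have : deriv (deriv D) 0 = 0 := by rw [e3.deriv_eq]; simp
  linarith

lemma lap_ge_of_touch (n : ℕ) (F : EuclideanSpace ℝ (Fin n) → ℝ) (hF : ContDiff ℝ 2 F)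
    (x c : EuclideanSpace ℝ (Fin n)) (G G1 : ℝ → ℝ) (G2 : ℝ)
    (hG : ∀ᶠ R in nhds (‖x - c‖ ^ 2), HasDerivAt G (G1 R) R)
    (hG1 : HasDerivAt G1 G2 (‖x - c‖ ^ 2))
    (hle : ∀ᶠ y in nhds x, G (‖y - c‖ ^ 2) ≤ F y) (heq : G (‖x - c‖ ^ 2) = F x) :
    4 * ‖x - c‖ ^ 2 * G2 + 2 * n * G1 (‖x - c‖ ^ 2) ≤ lap n F x := by
  have key : ∀ i : Fin n, 4 * ((x - c) i) ^ 2 * G2 + 2 * G1 (‖x - c‖ ^ 2) ≤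
      fderiv ℝ (fun y => fderiv ℝ F y (EuclideanSpace.single i 1)) x
        (EuclideanSpace.single i 1) := by
    intro i
    set e : EuclideanSpace ℝ (Fin n) := EuclideanSpace.single i 1 with he
    set b : ℝ := (x - c) i with hb
    have hline : ∀ s : ℝ, HasDerivAt (fun s : ℝ => x + s • e) e s := by
      intro s
      simpa using ((hasDerivAt_id s).smul_const e).const_add x
    have hnorm : ∀ s : ℝ, ‖x + s • e - c‖ ^ 2 = ‖x - c‖ ^ 2 + 2 * b * s + s ^ 2 := by
      intro s
      have : x + s • e - c = (x - c) + s • e := by abel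
      rw [this, norm_add_sq_real, norm_smul, inner_smul_right]
      have h1 : ‖e‖ = 1 := by simp [he]
      have h2 : inner ℝ (x - c) e = b := by
        simp [he, hb, EuclideanSpace.inner_single_right]
      rw [h1, h2]
      simp
      ring
    set q : ℝ → ℝ := fun s => ‖x - c‖ ^ 2 + 2 * b * s + s ^ 2 with hq
    have hq0 : q 0 = ‖x - c‖ ^ 2 := by simp [hq]
    have hqd : ∀ s, HasDerivAt q (2 * b + 2 * s) s := by
      intro s
      have h1 := ((hasDerivAt_id s).const_mul (2 * b)).const_add (‖x - c‖ ^ 2)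
      have h2 := h1.add (hasDerivAt_pow 2 s)
      refine HasDerivAt.congr_deriv h2 ?_
      simp
    have hqc : Tendsto q (nhds 0) (nhds (‖x - c‖ ^ 2)) := by
      have := (hqd 0).continuousAt.tendsto
      rwa [hq0] at this
    have hlc : Tendsto (fun s : ℝ => x + s • e) (nhds 0) (nhds x) := by
      have := (hline 0).continuousAt.tendsto
      simpa using this
    have hFd : Differentiable ℝ F := hF.differentiable (by norm_num)
    have hF1 : Differentiable ℝ (fun y => fderiv ℝ F y e) := by
      have : ContDiff ℝ 1 (fun y => fderiv ℝ F y) := hF.fderiv_right (by norm_num)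
      exact (this.differentiable (by norm_num)).clm_apply (differentiable_const e)
    have hD := second_deriv_nonneg_of_min (fun s => F (x + s • e) - G (q s))
      (fun s => fderiv ℝ F (x + s • e) e - G1 (q s) * (2 * b + 2 * s))
      (fderiv ℝ (fun y => fderiv ℝ F y e) x e - (G2 * (2 * b) * (2 * b) + G1 (‖x-c‖^2) * 2))
      ?_ ?_ ?_
    · nlinarith [hD]
    · have := hlc.eventually hle
      filter_upwards [this] with s hs
      have h0 : F (x + (0:ℝ) • e) - G (q 0) = 0 := by
        rw [hq0]; simp [heq]
      rw [h0]
      rw [hnorm s] at hs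
      linarith
    · filter_upwards [hqc.eventually hG] with s hs
      have h1 : HasDerivAt (fun s => F (x + s • e)) (fderiv ℝ F (x + s • e) e) s :=
        (hFd (x + s • e)).hasFDerivAt.comp_hasDerivAt s (hline s)
      exact h1.sub (hs.comp s (hqd s))
    · have h1 : HasDerivAt (fun s : ℝ => fderiv ℝ F (x + s • e) e)
          (fderiv ℝ (fun y => fderiv ℝ F y e) x e) 0 := by
        have hx : HasFDerivAt (fun y => fderiv ℝ F y e) (fderiv ℝ (fun y => fderiv ℝ F y e) x)
          (x + (0:ℝ) • e) := by
          simpa using (hF1 x).hasFDerivAt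
        exact hx.comp_hasDerivAt (0:ℝ) (hline 0)
      have hG1' : HasDerivAt G1 G2 (q 0) := by rw [hq0]; exact hG1
      have h2 := hG1'.comp (0:ℝ) (hqd 0)
      have h3 : HasDerivAt (fun s : ℝ => 2 * b + 2 * s) 2 0 := by
        simpa using ((hasDerivAt_id (0:ℝ)).const_mul 2).const_add (2 * b)
      have h4 := h1.sub (h2.mul h3)
      refine HasDerivAt.congr_deriv h4 ?_
      simp only [Function.comp, hq0]
      ring
  have hs := Finset.sum_le_sum (s := Finset.univ) fun i _ => key i
  have hn2 : ‖x - c‖ ^ 2 = ∑ i, ((x - c) i) ^ 2 := by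
    rw [EuclideanSpace.norm_sq_eq]; simp
  unfold lap
  refine le_trans (le_of_eq ?_) hs
  rw [Finset.sum_add_distrib, ← Finset.sum_mul, ← Finset.mul_sum, ← hn2]
  simp
  ring

lemma deriv_le_of_touch_left (f g : ℝ → ℝ) (t0 t f' g' : ℝ) (ht : t0 < t)
    (hf : HasDerivAt f f' t) (hg : HasDerivAt g g' t)
    (hle : ∀ s ∈ Set.Icc t0 t, g s ≤ f s) (heq : g t = f t) : f' ≤ g' := by
  have h := (hf.sub hg)
  rw [hasDerivAt_iff_tendsto_slope] at h
  have h2 := h.mono_left (nhdsWithin_mono t (s := Set.Iio t) (t := {t}ᶜ) (by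
    intro s hs; simpa using (ne_of_lt hs)))
  have : f' - g' ≤ 0 := by
    refine le_of_tendsto h2 ?_
    have hm : Set.Ioo t0 t ∈ nhdsWithin t (Set.Iio t) := Ioo_mem_nhdsLT ht
    filter_upwards [hm] with s hs
    rw [slope_def_field]
    apply div_nonpos_of_nonneg_of_nonpos
    · have := hle s ⟨hs.1.le, hs.2.le⟩
      simp only [Pi.sub_apply]
      linarith
    · linarith [hs.2]
  linarith

lemma first_touch {E : Type*} [TopologicalSpace E] (U v : E → ℝ → ℝ) (t0 t1 : ℝ)
    (hU : ContinuousOn (fun q : E × ℝ => U q.1 q.2) (Set.univ ×ˢ Set.Icc t0 t1))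
    (hv : ContinuousOn (fun q : E × ℝ => v q.1 q.2) (Set.univ ×ˢ Set.Icc t0 t1))
    (K : Set E) (hK : IsCompact K)
    (hout : ∀ x ∉ K, ∀ t ∈ Set.Icc t0 t1, U x t < v x t)
    (h0 : ∀ x, U x t0 < v x t0)
    (htouch : ∀ x, ∀ t ∈ Set.Ioc t0 t1, U x t = v x t →
      (∀ y, ∀ s ∈ Set.Icc t0 t, U y s ≤ v y s) → False) :
    ∀ x, ∀ t ∈ Set.Icc t0 t1, U x t < v x t := by
  by_contra hcon
  push Not at hcon
  obtain ⟨x1, s1, hs1, hx1⟩ := hcon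
  have hKc : IsCompact (K ×ˢ Set.Icc t0 t1) := hK.prod isCompact_Icc
  have hsub : K ×ˢ Set.Icc t0 t1 ⊆ (Set.univ : Set E) ×ˢ Set.Icc t0 t1 :=
    Set.prod_mono (Set.subset_univ _) le_rfl
  set f : E × ℝ → ℝ := fun q => U q.1 q.2 - v q.1 q.2 with hf
  have hfc : ContinuousOn f ((Set.univ : Set E) ×ˢ Set.Icc t0 t1) := hU.sub hv
  have hfK := hfc.mono hsub
  obtain ⟨W, hWc, hW⟩ := continuousOn_iff_isClosed.1 hfK (Set.Ici 0) isClosed_Ici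
  have hZ : IsCompact (f ⁻¹' (Set.Ici 0) ∩ K ×ˢ Set.Icc t0 t1) := by
    rw [hW]; exact hKc.inter_left hWc
  have hne : (f ⁻¹' (Set.Ici 0) ∩ K ×ˢ Set.Icc t0 t1).Nonempty := by
    refine ⟨(x1, s1), ?_, ?_, hs1⟩
    · simp only [hf, Set.mem_preimage, Set.mem_Ici]; linarith
    · by_contra hx
      exact absurd (hout x1 hx s1 hs1) (not_lt.2 hx1)
  obtain ⟨⟨x, t⟩, ⟨hxt0, hxK, htI⟩, hmin⟩ := hZ.exists_isMinOn hne continuous_snd.continuousOn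
  simp only [hf, Set.mem_preimage, Set.mem_Ici] at hxt0 hxK htI
  have hlt : ∀ y, ∀ s ∈ Set.Ico t0 t, U y s < v y s := by
    intro y s hs
    by_contra hc
    push Not at hc
    have hsI : s ∈ Set.Icc t0 t1 := ⟨hs.1, hs.2.le.trans htI.2⟩
    have hyK : y ∈ K := by
      by_contra hy
      exact absurd (hout y hy s hsI) (not_lt.2 hc)
    have hm : (y, s) ∈ f ⁻¹' (Set.Ici 0) ∩ K ×ˢ Set.Icc t0 t1 := by
      refine ⟨?_, hyK, hsI⟩
      simp only [hf, Set.mem_preimage, Set.mem_Ici]; linarith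
    have := hmin hm
    simp only [Set.mem_ofPred_eq] at this
    linarith [hs.2]
  have ht0 : t0 < t := by
    rcases htI.1.lt_or_eq with h | h
    · exact h
    · subst h; linarith [h0 x]
  have hle : ∀ y, U y t ≤ v y t := by
    intro y
    have hc : ContinuousWithinAt f ((Set.univ : Set E) ×ˢ Set.Icc t0 t1) (y, t) :=
      hfc (y, t) ⟨Set.mem_univ _, htI⟩
    have hl : Tendsto (fun s : ℝ => (y, s)) (nhdsWithin t (Set.Iio t))
        (nhdsWithin (y, t) ((Set.univ : Set E) ×ˢ Set.Icc t0 t1)) := by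
      rw [tendsto_nhdsWithin_iff]
      constructor
      · exact ((continuous_const.prodMk continuous_id).tendsto t).mono_left nhdsWithin_le_nhds
      · have hm : Set.Ioo t0 t ∈ nhdsWithin t (Set.Iio t) := Ioo_mem_nhdsLT ht0
        filter_upwards [hm] with s hs
        exact ⟨Set.mem_univ _, hs.1.le, hs.2.le.trans htI.2⟩
    have h3 : f (y, t) ≤ 0 := by
      refine le_of_tendsto (hc.tendsto.comp hl) ?_
      have hm : Set.Ioo t0 t ∈ nhdsWithin t (Set.Iio t) := Ioo_mem_nhdsLT ht0
      filter_upwards [hm] with s hs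
      have := hlt y s ⟨hs.1.le, hs.2⟩
      simp only [hf, Function.comp]
      linarith
    simp only [hf] at h3
    linarith
  refine htouch x t ⟨ht0, htI.2⟩ (le_antisymm (hle x) (by linarith)) ?_
  intro y s hs
  rcases hs.2.lt_or_eq with h | h
  · exact (hlt y s ⟨hs.1, h⟩).le
  · rw [h]; exact hle y

lemma params (n : ℕ) (hn : 10 < n) (p γ : ℝ) (hp : pc n < p)
    (hγ : γ ∈ Set.Ioo (nuExp p + lam1 n p) (((n : ℝ) - 2) / 2)) :
    1 < p ∧ 0 < nuExp p ∧ 0 < lam1 n p ∧ 0 < Lconst n p ∧ nuExp p < γ ∧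
    nuExp p * (p - 1) = 2 ∧ 0 < kappaOf n p γ ∧
    (1 + kappaOf n p γ) * p * Lconst n p ^ (p - 1) = γ * ((n : ℝ) - 2 - γ) := by
  have hN : (11 : ℝ) ≤ n := by exact_mod_cast hn
  set N : ℝ := (n : ℝ) with hNdef
  have hs : 0 ≤ Real.sqrt (N - 1) := Real.sqrt_nonneg _
  have hD : 0 < (N - 2) * (N - 10) := by apply mul_pos <;> linarith
  have h1 : (N - 2) ^ 2 - 4 * N + 8 * Real.sqrt (N - 1) < p * ((N - 2) * (N - 10)) := by
    unfold pc at hp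
    rwa [div_lt_iff₀ hD] at hp
  have h2 : 4 * N - 16 < (p - 1) * ((N - 2) * (N - 10)) := by nlinarith
  have hp1 : 1 < p := by
    by_contra hc
    push Not at hc
    nlinarith
  have h3 : 4 < (p - 1) * (N - 2) := by
    have : 4 * (N - 10) < ((p - 1) * (N - 2)) * (N - 10) := by nlinarith
    exact lt_of_mul_lt_mul_right this (by linarith)
  have hp0 : 0 < p - 1 := by linarith
  set ν := nuExp p with hν
  have hνp : ν * (p - 1) = 2 := by
    rw [hν]; unfold nuExp; field_simp
  have hν0 : 0 < ν := by rw [hν]; unfold nuExp; positivity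
  have hν2 : 2 * ν < N - 2 := by
    have : (2 * ν) * (p - 1) < (N - 2) * (p - 1) := by nlinarith
    exact lt_of_mul_lt_mul_right this hp0.le
  set S := Real.sqrt ((N - 2 - 2 * ν) ^ 2 - 8 * (N - 2 - ν)) with hS
  have hlam : lam1 n p = ((N - 2 - 2 * ν) - S) / 2 := rfl
  have hS0 : 0 ≤ S := Real.sqrt_nonneg _
  have hSlt : S < N - 2 - 2 * ν := by
    rw [hS, Real.sqrt_lt' (by linarith)]
    linarith
  have hlam0 : 0 < lam1 n p := by rw [hlam]; linarith
  have hSpos : 0 < S := by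
    have := hγ.1.trans hγ.2
    rw [hlam] at this
    linarith
  have hSsq : S ^ 2 = (N - 2 - 2 * ν) ^ 2 - 8 * (N - 2 - ν) :=
    Real.sq_sqrt (Real.sqrt_pos.1 hSpos).le
  have hbase : 0 < ν * (N - 2 - ν) := by apply mul_pos <;> linarith
  have hL0 : 0 < Lconst n p := Real.rpow_pos_of_pos hbase _
  have hLp : Lconst n p ^ (p - 1) = ν * (N - 2 - ν) := by
    unfold Lconst
    rw [← Real.rpow_mul hbase.le, one_div, inv_mul_cancel₀ hp0.ne', Real.rpow_one]
  have hpν : p * ν = ν + 2 := by linarith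
  have hpL : p * Lconst n p ^ (p - 1) = (ν + 2) * (N - 2 - ν) := by
    rw [hLp, ← hpν]; ring
  have hpLpos : 0 < p * Lconst n p ^ (p - 1) := by
    rw [hpL]; apply mul_pos <;> linarith
  have hroot : (ν + lam1 n p) * (N - 2 - (ν + lam1 n p)) = (ν + 2) * (N - 2 - ν) := by
    rw [hlam]; nlinarith
  have hgt : (ν + 2) * (N - 2 - ν) < γ * (N - 2 - γ) := by
    rw [← hroot]
    have a1 := hγ.1
    have a2 := hγ.2
    nlinarith
  refine ⟨hp1, hν0, hlam0, hL0, by linarith [hγ.1], hνp, ?_, ?_⟩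
  · unfold kappaOf
    rw [sub_pos, lt_div_iff₀ hpLpos, hpL]
    linarith
  · unfold kappaOf
    rw [mul_assoc, add_sub_cancel, div_mul_cancel₀ _ hpLpos.ne']

lemma phi_derivs (n : ℕ) (p α : ℝ) (φ : ℝ → ℝ) (a : ℝ) (hφ : IsSteadyStateA n p α φ a)
    (r : ℝ) (hr : 0 < r) :
    HasDerivAt φ (deriv φ r) r ∧ HasDerivAt (deriv φ) (deriv (deriv φ) r) r := by
  have hmem : Set.Ioi (0:ℝ) ∈ nhds r := Ioi_mem_nhds hr
  have h1 := hφ.smooth.contDiffAt hmem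
  refine ⟨(h1.differentiableAt (by norm_num)).hasDerivAt, ?_⟩
  have h2 : ContDiffOn ℝ 1 (deriv φ) (Set.Ioi 0) :=
    ((contDiffOn_succ_iff_deriv_of_isOpen (n := 1) isOpen_Ioi).1 (by rw [one_add_one_eq_two]; exact hφ.smooth)).2.2
  exact ((h2.contDiffAt hmem).differentiableAt (by norm_num)).hasDerivAt

lemma phi_near_zero (n : ℕ) (hn : 10 < n) (p α : ℝ) (hp : 1 < p) (φ : ℝ → ℝ) (a : ℝ)
    (hφ : IsSteadyStateA n p α φ a) :
    ∀ r ≥ (0:ℝ), α - α ^ p * r ^ 2 / (2 * n) ≤ φ r := by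
  have hN : (11 : ℝ) ≤ n := by exact_mod_cast hn
  have hα : 0 < α := by rw [← hφ.val0]; exact hφ.pos 0 le_rfl
  obtain ⟨k, hk⟩ : ∃ k : ℕ, n = k + 1 := ⟨n - 1, by omega⟩
  have hkn : (n : ℝ) = k + 1 := by rw [hk]; push_cast; ring
  have hle : ∀ r > (0:ℝ), φ r ≤ α := by
    intro r hr
    rw [← hφ.val0]
    exact (hφ.anti (Set.mem_Ici.2 le_rfl) (Set.mem_Ici.2 hr.le) hr).le
  have hαp : 0 < α ^ p := Real.rpow_pos_of_pos hα p
  set H : ℝ → ℝ := fun r => r ^ k * deriv φ r + α ^ p * r ^ (k + 1) / n with hH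
  have hHd : ∀ r > (0:ℝ), HasDerivAt H (r ^ k * (α ^ p - φ r ^ p)) r := by
    intro r hr
    have h1 := (hasDerivAt_pow k r).mul (phi_derivs n p α φ a hφ r hr).2
    have h2 := ((hasDerivAt_pow (k + 1) r).const_mul (α ^ p)).div_const (n : ℝ)
    have h3 := h1.add h2
    refine HasDerivAt.congr_deriv h3 ?_
    have hode := hφ.ode r hr
    have e1 : deriv (deriv φ) r = - (((n:ℝ) - 1) / r * deriv φ r) - φ r ^ p := by linarith
    rw [e1, hkn]
    have hk1 : k - 1 + 1 = k := by omega
    have e2 : r ^ k = r ^ (k - 1) * r := by rw [← pow_succ, hk1]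
    have e3 : (k:ℝ) + 1 ≠ 0 := by positivity
    simp only [Nat.add_sub_cancel]
    push_cast
    rw [e2]
    field_simp
    ring
  have hmono : MonotoneOn H (Set.Ioi 0) := by
    apply monotoneOn_of_deriv_nonneg (convex_Ioi 0)
    · intro r hr; exact (hHd r hr).continuousAt.continuousWithinAt
    · intro r hr; rw [interior_Ioi] at hr
      exact (hHd r hr).differentiableAt.differentiableWithinAt
    · intro r hr; rw [interior_Ioi] at hr
      rw [(hHd r hr).deriv]
      apply mul_nonneg (pow_nonneg (le_of_lt hr) _)
      have := Real.rpow_le_rpow (hφ.pos r (le_of_lt hr)).le (hle r hr) (by linarith : 0 ≤ p)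
      linarith
  have hH0 : ∀ r > (0:ℝ), 0 ≤ H r := by
    intro r1 hr1
    by_contra hneg
    push Not at hneg
    set h : ℝ := - H r1 with hh
    have hhpos : 0 < h := by linarith
    set r2 := min r1 1 with hr2
    have hr2pos : 0 < r2 := lt_min hr1 one_pos
    have hbd : ∀ r ∈ Set.Ioc 0 r2, deriv φ r ≤ - (h / r) := by
      intro r hr
      have hr1' : r ≤ r1 := hr.2.trans (min_le_left _ _)
      have hr1'' : r ≤ 1 := hr.2.trans (min_le_right _ _)
      have h1 : H r ≤ H r1 := hmono hr.1 hr1 hr1'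
      have hr0 := hr.1
      have h2 : r ^ k * deriv φ r ≤ - h := by
        have : 0 ≤ α ^ p * r ^ (k + 1) / n := by positivity
        simp only [hH] at h1 hh ⊢
        linarith
      have h3 : r ^ k ≤ r := by
        calc r ^ k ≤ r ^ 1 := pow_le_pow_of_le_one hr0.le hr1'' (by omega)
          _ = r := pow_one r
      have hd : deriv φ r < 0 := by
        by_contra hc
        push Not at hc
        have : 0 ≤ r ^ k * deriv φ r := by positivity
        linarith
      rw [← neg_div, le_div_iff₀ hr0]
      nlinarith
    have hanti : AntitoneOn (fun r => φ r + h * Real.log r) (Set.Ioc 0 r2) := by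
      have hd : ∀ r ∈ Set.Ioc 0 r2, HasDerivAt (fun r => φ r + h * Real.log r)
          (deriv φ r + h * r⁻¹) r := by
        intro r hr
        exact (phi_derivs n p α φ a hφ r hr.1).1.add
          ((Real.hasDerivAt_log hr.1.ne').const_mul h)
      apply antitoneOn_of_deriv_nonpos (convex_Ioc 0 r2)
      · intro r hr; exact (hd r hr).continuousAt.continuousWithinAt
      · intro r hr; exact (hd r (interior_subset hr)).differentiableAt.differentiableWithinAt
      · intro r hr
        rw [(hd r (interior_subset hr)).deriv]
        have := hbd r (interior_subset hr)
        rw [div_eq_mul_inv] at this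
        linarith
    have hlog := Real.tendsto_log_nhdsGT_zero
    have hev := hlog.eventually (eventually_lt_atBot ((φ r2 + h * Real.log r2 - α) / h))
    obtain ⟨r, hr, hrI⟩ := (hev.and (Ioc_mem_nhdsGT hr2pos)).exists
    have h1 := hanti hrI ⟨hr2pos, le_rfl⟩ hrI.2
    simp only at h1
    rw [lt_div_iff₀ hhpos] at hr
    have := hle r hrI.1
    nlinarith
  have hmono2 : MonotoneOn (fun r => φ r + α ^ p * r ^ 2 / (2 * n)) (Set.Ici 0) := by
    have hd : ∀ r > (0:ℝ), HasDerivAt (fun r => φ r + α ^ p * r ^ 2 / (2 * n))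
        (deriv φ r + α ^ p * r / n) r := by
      intro r hr
      have h2 := ((hasDerivAt_pow 2 r).const_mul (α ^ p)).div_const (2 * (n : ℝ))
      refine HasDerivAt.congr_deriv ((phi_derivs n p α φ a hφ r hr).1.add h2) ?_
      simp
      field_simp
    apply monotoneOn_of_deriv_nonneg (convex_Ici 0)
    · exact hφ.cont.add (by fun_prop)
    · intro r hr; rw [interior_Ici] at hr
      exact (hd r hr).differentiableAt.differentiableWithinAt
    · intro r hr; rw [interior_Ici] at hr
      rw [(hd r hr).deriv]
      have h1 := hH0 r hr
      have h2 : H r = r ^ k * (deriv φ r + α ^ p * r / n) := by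
        simp only [hH]; ring
      rw [h2] at h1
      exact nonneg_of_mul_nonneg_right h1 (pow_pos hr k)
  intro r hr
  have := hmono2 (Set.mem_Ici.2 le_rfl) (Set.mem_Ici.2 hr) hr
  simp only [hφ.val0] at this
  norm_num at this
  linarith

lemma phi_far (n : ℕ) (p α : ℝ) (φ : ℝ → ℝ) (a : ℝ) (hφ : IsSteadyStateA n p α φ a)
    (hp : 1 < p) (hνp : nuExp p * (p - 1) = 2)
    (hlam : 0 < lam1 n p) (hL : 0 < Lconst n p) :
    ∃ R0 ≥ (1:ℝ), ∃ c > 0, ∀ r ≥ R0,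
      Lconst n p / 2 * r ^ (-nuExp p) ≤ φ r ∧
      Lconst n p ^ (p - 1) * r ^ (-2 : ℝ) * (1 - c * r ^ (-lam1 n p)) ≤ φ r ^ (p - 1) := by
  set ν := nuExp p
  set l := lam1 n p
  set L := Lconst n p
  have hexp := hφ.expansion.def (one_pos)
  have ha := hφ.a_pos
  set c1 := (a + 1) / L with hc1
  have hc1pos : 0 < c1 := by positivity
  have hdec : Tendsto (fun r : ℝ => c1 * r ^ (-l)) atTop (nhds 0) := by
    simpa using (tendsto_rpow_neg_atTop hlam).const_mul c1
  have hdec' := hdec.eventually (eventually_le_nhds (show (0:ℝ) < 1/2 by norm_num))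
  obtain ⟨R, hR⟩ := (hexp.and hdec').exists_forall_of_atTop
  refine ⟨max R 1, le_max_right _ _, p * c1, by positivity, ?_⟩
  intro r hr
  have hrR : R ≤ r := (le_max_left _ _).trans hr
  have hr1 : 1 ≤ r := (le_max_right _ _).trans hr
  have hr0 : 0 < r := by linarith
  obtain ⟨h1, h2⟩ := hR r hrR
  have hsplit : r ^ (-ν - l) = r ^ (-ν) * r ^ (-l) := by
    rw [← Real.rpow_add hr0]; ring_nf
  have hrν : 0 < r ^ (-ν) := Real.rpow_pos_of_pos hr0 _
  have hrl : 0 < r ^ (-l) := Real.rpow_pos_of_pos hr0 _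
  rw [hsplit, Real.norm_eq_abs, Real.norm_eq_abs, one_mul,
    abs_of_pos (mul_pos hrν hrl)] at h1
  have h3 := (abs_le.1 h1).1
  have hlow : L * r ^ (-ν) * (1 - c1 * r ^ (-l)) ≤ φ r := by
    have : L * r ^ (-ν) * (1 - c1 * r ^ (-l)) = L * r ^ (-ν) - (a + 1) * (r ^ (-ν) * r ^ (-l)) := by
      rw [hc1]; field_simp
    rw [this]; linarith
  have hx0 : 0 < c1 * r ^ (-l) := by positivity
  set x := c1 * r ^ (-l) with hx
  constructor
  · refine le_trans ?_ hlow
    have : 0 < L * r ^ (-ν) := by positivity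
    nlinarith
  · have h4 : (L * r ^ (-ν) * (1 - x)) ^ (p - 1) ≤ φ r ^ (p - 1) :=
      Real.rpow_le_rpow (by apply mul_nonneg (by positivity); linarith) hlow (by linarith)
    refine le_trans ?_ h4
    rw [Real.mul_rpow (by positivity) (by linarith), Real.mul_rpow hL.le hrν.le,
      ← Real.rpow_mul hr0.le]
    have e : -ν * (p - 1) = -2 := by linarith
    rw [e]
    apply mul_le_mul_of_nonneg_left _ (by positivity)
    have h5 : 1 + p * (-x) ≤ (1 + (-x)) ^ p :=
      one_add_mul_self_le_rpow_one_add (by linarith) (by linarith)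
    have h6 : (1 - x) ^ p ≤ (1 - x) ^ (p - 1) :=
      Real.rpow_le_rpow_of_exponent_ge (by linarith) (by linarith) (by linarith)
    have : 1 + (-x) = 1 - x := by ring
    rw [this] at h5
    linarith

lemma phi_lower (n : ℕ) (p α : ℝ) (φ : ℝ → ℝ) (a : ℝ) (hφ : IsSteadyStateA n p α φ a)
    (hp : 1 < p) (hν : 0 < nuExp p) (hνp : nuExp p * (p - 1) = 2)
    (hlam : 0 < lam1 n p) (hL : 0 < Lconst n p) :
    ∃ c > 0, ∀ r ≥ (0:ℝ), c * (1 + r) ^ (-nuExp p) ≤ φ r := by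
  obtain ⟨R0, hR0, c, hc, h⟩ := phi_far n p α φ a hφ hp hνp hlam hL
  have hR00 : 0 ≤ R0 := by linarith
  refine ⟨min (Lconst n p / 2) (φ R0), lt_min (by linarith) (hφ.pos R0 hR00), ?_⟩
  intro r hr
  have hpos : 0 < (1 + r) ^ (-nuExp p) := Real.rpow_pos_of_pos (by linarith) _
  rcases le_total r R0 with h1 | h1
  · have h2 : φ R0 ≤ φ r := hφ.anti.antitoneOn hr hR00 h1
    have h3 : (1 + r) ^ (-nuExp p) ≤ 1 :=
      Real.rpow_le_one_of_one_le_of_nonpos (by linarith) (by linarith)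
    have h4 := hφ.pos R0 hR00
    calc _ ≤ φ R0 * (1 + r) ^ (-nuExp p) :=
          mul_le_mul_of_nonneg_right (min_le_right _ _) hpos.le
      _ ≤ φ R0 * 1 := mul_le_mul_of_nonneg_left h3 h4.le
      _ ≤ φ r := by linarith
  · have h2 := (h r h1).1
    have h3 : (1 + r) ^ (-nuExp p) ≤ r ^ (-nuExp p) :=
      Real.rpow_le_rpow_of_nonpos (by linarith) (by linarith) (by linarith)
    calc _ ≤ Lconst n p / 2 * (1 + r) ^ (-nuExp p) :=
          mul_le_mul_of_nonneg_right (min_le_left _ _) hpos.le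
      _ ≤ Lconst n p / 2 * r ^ (-nuExp p) := mul_le_mul_of_nonneg_left h3 (by linarith)
      _ ≤ φ r := h2

lemma phi_upper (n : ℕ) (p α : ℝ) (φ : ℝ → ℝ) (a : ℝ) (hφ : IsSteadyStateA n p α φ a)
    (hν : 0 < nuExp p) (hL : 0 < Lconst n p) :
    ∃ C > 0, ∀ r ≥ (0:ℝ), φ r ≤ C * (1 + r) ^ (-nuExp p) := by
  have hα : 0 < α := by rw [← hφ.val0]; exact hφ.pos 0 le_rfl
  refine ⟨max (Lconst n p) α * 2 ^ (nuExp p), by positivity, ?_⟩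
  intro r hr
  have key : ∀ s : ℝ, 0 < s → 1 + r ≤ 2 * s → s ^ (-nuExp p) ≤ 2 ^ (nuExp p) * (1 + r) ^ (-nuExp p) := by
    intro s hs h
    have h1 : s ^ (-nuExp p) ≤ ((1 + r) / 2) ^ (-nuExp p) :=
      Real.rpow_le_rpow_of_nonpos (by linarith) (by linarith) (by linarith)
    rw [Real.div_rpow (by linarith) (by norm_num), Real.rpow_neg (x := 2) (by norm_num), div_inv_eq_mul] at h1
    linarith
  rcases le_total r 1 with h | h
  · have h1 := key 1 one_pos (by linarith)
    rw [Real.one_rpow] at h1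
    have h2 : φ r ≤ α := by
      rw [← hφ.val0]; exact hφ.anti.antitoneOn (Set.mem_Ici.2 le_rfl) (Set.mem_Ici.2 hr) hr
    calc φ r ≤ max (Lconst n p) α * 1 := by rw [mul_one]; exact h2.trans (le_max_right _ _)
      _ ≤ max (Lconst n p) α * (2 ^ (nuExp p) * (1 + r) ^ (-nuExp p)) :=
        mul_le_mul_of_nonneg_left h1 (by positivity)
      _ = _ := by ring
  · have h1 := key r (by linarith) (by linarith)
    have h2 := hφ.upper r (by linarith)
    calc φ r ≤ Lconst n p * r ^ (-nuExp p) := h2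
      _ ≤ max (Lconst n p) α * r ^ (-nuExp p) :=
        mul_le_mul_of_nonneg_right (le_max_left _ _) (by positivity)
      _ ≤ max (Lconst n p) α * (2 ^ (nuExp p) * (1 + r) ^ (-nuExp p)) :=
        mul_le_mul_of_nonneg_left h1 (by positivity)
      _ = _ := by ring

lemma lap_ge_radial (n : ℕ) (F : EuclideanSpace ℝ (Fin n) → ℝ) (hF : ContDiff ℝ 2 F)
    (x : EuclideanSpace ℝ (Fin n)) (hx : 0 < ‖x‖) (g g1 : ℝ → ℝ) (g2 : ℝ)
    (hg : ∀ r > 0, HasDerivAt g (g1 r) r)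
    (hg1 : HasDerivAt g1 g2 ‖x‖)
    (hle : ∀ᶠ y in nhds x, g ‖y‖ ≤ F y) (heq : g ‖x‖ = F x) :
    g2 + ((n : ℝ) - 1) / ‖x‖ * g1 ‖x‖ ≤ lap n F x := by
  set r := ‖x‖ with hr
  have hr2 : 0 < r ^ 2 := by positivity
  have hsq : Real.sqrt (r ^ 2) = r := Real.sqrt_sq hx.le
  have h := lap_ge_of_touch n F hF x 0 (fun R => g (Real.sqrt R))
    (fun R => g1 (Real.sqrt R) * (1 / (2 * Real.sqrt R)))
    (g2 * (1 / (2 * r)) * (1 / (2 * r)) + g1 r * (- (2 * (1 / (2 * r))) / (2 * r) ^ 2)) ?_ ?_ ?_ ?_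
  · simp only [sub_zero, ← hr, hsq] at h
    refine le_trans (le_of_eq ?_) h
    field_simp
    ring
  · simp only [sub_zero, ← hr]
    filter_upwards [Ioi_mem_nhds hr2] with R hR
    exact (hg _ (Real.sqrt_pos.2 hR)).comp R (Real.hasDerivAt_sqrt (ne_of_gt hR))
  · simp only [sub_zero, ← hr]
    have a1 : HasDerivAt Real.sqrt (1 / (2 * r)) (r ^ 2) := by
      have := Real.hasDerivAt_sqrt hr2.ne'
      rwa [hsq] at this
    have hg1' : HasDerivAt g1 g2 (Real.sqrt (r ^ 2)) := by rw [hsq]; exact hg1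
    have a2 := hg1'.comp (r ^ 2) a1
    have a3 := ((a1.const_mul 2).inv (by rw [hsq]; positivity))
    have a4 := a2.mul a3
    have e : (fun R => g1 (Real.sqrt R) * (1 / (2 * Real.sqrt R))) =
        ((g1 ∘ Real.sqrt) * fun R => (2 * Real.sqrt R)⁻¹) := by
      funext R; simp
    rw [e]
    refine HasDerivAt.congr_deriv a4 ?_
    simp only [Function.comp, hsq, Pi.inv_apply, one_div]
  · filter_upwards [hle] with y hy
    simpa [Real.sqrt_sq (norm_nonneg y)] using hy
  · simpa [Real.sqrt_sq (norm_nonneg x)] using heq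

lemma exists_psi (N γ R0 c l : ℝ) (hγ0 : 0 < γ) (hγ : γ < (N - 2) / 2) (hR0 : 1 ≤ R0)
    (hc : 0 < c) (hl : 0 < l) :
    ∃ rm ≥ R0, ∃ A > 0, ∃ δ > 0,
      (∀ r ≥ rm, 0 < r ^ (-γ) - A * r ^ (-(γ + δ))) ∧
      (∀ r > 0, r ^ (-γ) - A * r ^ (-(γ + δ)) ≤ rm ^ (-γ) - A * rm ^ (-(γ + δ))) ∧
      (∀ r ≥ rm, γ * (N - 2 - γ) * r ^ (-γ - 2) - A * ((γ + δ) * (N - 2 - (γ + δ)) * r ^ (-(γ + δ) - 2))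
        ≤ γ * (N - 2 - γ) * (r ^ (-2 : ℝ) * (1 - c * r ^ (-l))) *
          (r ^ (-γ) - A * r ^ (-(γ + δ)))) := by
  obtain ⟨δ, hδ0, hδ⟩ : ∃ δ > 0, δ < min l (N - 2 - 2 * γ) :=
    exists_between (lt_min hl (by linarith))
  have hδl : δ < l := hδ.trans_le (min_le_left _ _)
  have hδN : δ < N - 2 - 2 * γ := hδ.trans_le (min_le_right _ _)
  set K := γ * (N - 2 - γ) with hK
  have hK0 : 0 < K := by rw [hK]; apply mul_pos <;> linarith
  set d := δ * (N - 2 - 2 * γ - δ) with hd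
  have hd0 : 0 < d := by rw [hd]; apply mul_pos <;> linarith
  have htend : Tendsto (fun r : ℝ => γ / (γ + δ) * r ^ δ) atTop atTop :=
    (tendsto_rpow_atTop hδ0).const_mul_atTop (by positivity)
  obtain ⟨rm, hrm1, hrm⟩ := ((htend.eventually_ge_atTop (K * c / d)).and
    (eventually_ge_atTop R0)).exists
  have hrm0 : 0 < rm := by linarith
  set A := γ / (γ + δ) * rm ^ δ with hA
  have hA0 : 0 < A := by positivity
  have hsp : ∀ r : ℝ, 0 < r → r ^ (-(γ + δ)) = r ^ (-γ) * r ^ (-δ) := by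
    intro r hr; rw [← Real.rpow_add hr]; ring_nf
  have hmm : rm ^ δ * rm ^ (-δ) = 1 := by
    rw [← Real.rpow_add hrm0]; simp
  have hfrac : γ / (γ + δ) < 1 := by rw [div_lt_one (by positivity)]; linarith
  have hpos : ∀ r ≥ rm, 0 < r ^ (-γ) - A * r ^ (-(γ + δ)) := by
    intro r hr
    have hr0 : 0 < r := by linarith
    rw [hsp r hr0]
    have h1 : r ^ (-δ) ≤ rm ^ (-δ) := Real.rpow_le_rpow_of_nonpos hrm0 hr (by linarith)
    have h2 : 0 < r ^ (-γ) := by positivity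
    have h3 : A * r ^ (-δ) < 1 := by
      calc A * r ^ (-δ) ≤ A * rm ^ (-δ) := mul_le_mul_of_nonneg_left h1 hA0.le
        _ = γ / (γ + δ) * (rm ^ δ * rm ^ (-δ)) := by rw [hA]; ring
        _ < 1 := by rw [hmm, mul_one]; exact hfrac
    nlinarith
  refine ⟨rm, hrm, A, hA0, δ, hδ0, hpos, ?_, ?_⟩
  · intro r hr
    set y := (rm / r) ^ (γ + δ) with hy
    have hrr : 0 < rm / r := by positivity
    have hy0 : 0 < y := by positivity
    have hb : (1 + (y - 1)) ^ (γ / (γ + δ)) ≤ 1 + γ / (γ + δ) * (y - 1) :=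
      rpow_one_add_le_one_add_mul_self (by linarith) (by positivity) hfrac.le
    have e1 : (1 + (y - 1)) ^ (γ / (γ + δ)) = (rm / r) ^ γ := by
      rw [add_sub_cancel, hy, ← Real.rpow_mul hrr.le]
      congr 1
      field_simp
    rw [e1] at hb
    have e2 : r ^ (-γ) = rm ^ (-γ) * (rm / r) ^ γ := by
      rw [Real.div_rpow hrm0.le hr.le, Real.rpow_neg hrm0.le, Real.rpow_neg hr.le]
      field_simp
    have e3 : rm ^ δ * r ^ (-(γ + δ)) = rm ^ (-γ) * y := by
      rw [hy, Real.div_rpow hrm0.le hr.le, Real.rpow_neg hrm0.le, Real.rpow_neg hr.le,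
        Real.rpow_add hrm0]
      field_simp
    have e4 : A * r ^ (-(γ + δ)) = γ / (γ + δ) * (rm ^ (-γ) * y) := by
      rw [← e3, hA]; ring
    have e5 : A * rm ^ (-(γ + δ)) = γ / (γ + δ) * rm ^ (-γ) := by
      rw [hsp rm hrm0, hA]
      calc _ = γ / (γ + δ) * rm ^ (-γ) * (rm ^ δ * rm ^ (-δ)) := by ring
        _ = _ := by rw [hmm, mul_one]
    rw [e4, e5, e2]
    have : 0 < rm ^ (-γ) := by positivity
    nlinarith
  · intro r hr
    have hr0 : 0 < r := by linarith
    have hr1 : 1 ≤ r := by linarith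
    have h0 := hpos r hr
    have e1 : r ^ (-γ - 2) = r ^ (-γ) * r ^ (-2 : ℝ) := by
      rw [← Real.rpow_add hr0]; ring_nf
    have e2 : r ^ (-(γ + δ) - 2) = r ^ (-γ) * r ^ (-δ) * r ^ (-2 : ℝ) := by
      rw [← Real.rpow_add hr0, ← Real.rpow_add hr0]; ring_nf
    rw [hsp r hr0] at h0 ⊢
    rw [e1, e2]
    have hPg : 0 < r ^ (-γ) := by positivity
    have hPd : 0 < r ^ (-δ) := by positivity
    have hP2 : 0 < r ^ (-2 : ℝ) := by positivity
    have hPl : 0 < r ^ (-l) := by positivity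
    have hld : r ^ (-l) ≤ r ^ (-δ) := Real.rpow_le_rpow_of_exponent_le hr1 (by linarith)
    have hAd : K * c ≤ A * d := by rwa [div_le_iff₀ hd0] at hrm1
    have hid : (γ + δ) * (N - 2 - (γ + δ)) = K + d := by rw [hK, hd]; ring
    rw [hid]
    generalize r ^ (-γ) = X at *
    generalize r ^ (-δ) = Y at *
    generalize r ^ (-2 : ℝ) = Z at *
    generalize r ^ (-l) = W at *
    have hm : K * c * W * (X - A * (X * Y)) ≤ A * d * (X * Y) := by
      have a1 : X - A * (X * Y) ≤ X := by
        have : 0 < A * (X * Y) := by positivity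
        linarith
      calc K * c * W * (X - A * (X * Y)) ≤ K * c * W * X :=
            mul_le_mul_of_nonneg_left a1 (by positivity)
        _ ≤ K * c * Y * X := by
            apply mul_le_mul_of_nonneg_right _ hPg.le
            exact mul_le_mul_of_nonneg_left hld (by positivity)
        _ = K * c * (X * Y) := by ring
        _ ≤ _ := mul_le_mul_of_nonneg_right hAd (by positivity)
    have := mul_le_mul_of_nonneg_left hm hP2.le
    linarith

set_option maxHeartbeats 1000000 in
lemma persist (n : ℕ) (hn : 10 < n) (p : ℝ) (hp : 1 < p) (hν : 0 < nuExp p)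
    (hνp : nuExp p * (p - 1) = 2) (c2 : ℝ) (hc2 : 0 < c2) :
    ∃ T > 0, ∃ c3 > 0, ∀ (v : EuclideanSpace ℝ (Fin n) → ℝ → ℝ)
      (v₀ : EuclideanSpace ℝ (Fin n) → ℝ), IsBddClassicalSol n p v v₀ → ∀ t0 ≥ (0:ℝ),
      (∀ x, c2 * (1 + ‖x‖) ^ (-nuExp p) ≤ v x t0) →
      ∀ x, ∀ t ∈ Set.Icc t0 (t0 + T), c3 * (1 + ‖x‖) ^ (-nuExp p) ≤ v x t := by
  have hN : (11 : ℝ) ≤ n := by exact_mod_cast hn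
  set ν := nuExp p with hνdef
  set c4 : ℝ := 2 ^ (-ν) * c2 with hc4
  have hc40 : 0 < c4 := by positivity
  set q : ℝ := 2 / ((n : ℝ) + 2) with hq
  have hq0 : 0 < q := by positivity
  have hq1 : q ≤ 1 := by rw [hq, div_le_one (by positivity)]; linarith
  have hqsq : q ^ 2 ≤ 1 := pow_le_one₀ hq0.le hq1
  set T : ℝ := p * q ^ 2 * (c4 * q ^ 2 / 4) ^ (p - 1) / (16 * n) with hT
  have hT0 : 0 < T := by positivity
  refine ⟨T, hT0, c4 / 4, by positivity, ?_⟩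
  intro v v₀ hv t0 ht0 hlow x0 t1 ht1
  set ρ : ℝ := 1 + ‖x0‖ with hρ
  have hρ0 : 0 < ρ := by positivity
  set m : ℝ := c4 * ρ ^ (-ν) with hm
  have hm0 : 0 < m := by positivity
  have hmlow : ∀ y, ‖y - x0‖ ≤ ρ → m ≤ v y t0 := by
    intro y hy
    refine le_trans ?_ (hlow y)
    have h1 : 1 + ‖y‖ ≤ 2 * ρ := by
      have : ‖y‖ ≤ ‖y - x0‖ + ‖x0‖ := by
        simpa using norm_add_le (y - x0) x0
      linarith
    have h2 : (2 * ρ) ^ (-ν) ≤ (1 + ‖y‖) ^ (-ν) :=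
      Real.rpow_le_rpow_of_nonpos (by positivity) h1 (by linarith)
    rw [Real.mul_rpow (by norm_num) hρ0.le] at h2
    calc m = c2 * (2 ^ (-ν) * ρ ^ (-ν)) := by rw [hm, hc4]; ring
      _ ≤ _ := mul_le_mul_of_nonneg_left h2 hc2.le
  set δ : ℝ := m * q ^ 2 / 4 with hδ
  have hδ0 : 0 < δ := by positivity
  set f : ℝ → ℝ := fun t => m * (1 - (t - t0) / (2 * T)) with hf
  have hfle : ∀ t ∈ Set.Icc t0 (t0 + T), m / 2 ≤ f t ∧ f t ≤ m := by
    intro t ht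
    have h1 : 0 ≤ (t - t0) / (2 * T) := div_nonneg (by linarith [ht.1]) (by positivity)
    have h2 : (t - t0) / (2 * T) ≤ 1 / 2 := by
      rw [div_le_iff₀ (by positivity)]; linarith [ht.2]
    simp only [hf]
    constructor
    · have := mul_le_mul_of_nonneg_left h2 hm0.le
      linarith
    · have := mul_nonneg hm0.le h1
      linarith
  have hmρ : m ^ (p - 1) * ρ ^ 2 = c4 ^ (p - 1) := by
    rw [hm, Real.mul_rpow hc40.le (by positivity), ← Real.rpow_mul hρ0.le]
    have : -ν * (p - 1) = -2 := by linarith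
    rw [this, mul_assoc, ← Real.rpow_natCast ρ 2, ← Real.rpow_add hρ0]
    norm_num
  set U : EuclideanSpace ℝ (Fin n) → ℝ → ℝ :=
    fun y t => f t * (max 0 (1 - ‖y - x0‖ ^ 2 / ρ ^ 2)) ^ 2 - δ with hU
  have hmaxle : ∀ y, (max 0 (1 - ‖y - x0‖ ^ 2 / ρ ^ 2)) ^ 2 ≤ 1 := by
    intro y
    apply pow_le_one₀ (le_max_left _ _)
    apply max_le zero_le_one
    have : 0 ≤ ‖y - x0‖ ^ 2 / ρ ^ 2 := by positivity
    linarith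
  have hmaxz : ∀ y, ρ ≤ ‖y - x0‖ → max 0 (1 - ‖y - x0‖ ^ 2 / ρ ^ 2) = 0 := by
    intro y hy
    apply max_eq_left
    have : 1 ≤ ‖y - x0‖ ^ 2 / ρ ^ 2 := by
      rw [one_le_div (by positivity)]
      exact pow_le_pow_left₀ hρ0.le hy 2
    linarith
  have hout : ∀ y, ρ ≤ ‖y - x0‖ → ∀ t, U y t = -δ := by
    intro y hy t
    simp [hU, hmaxz y hy]
  have hres := first_touch U v t0 (t0 + T) ?_ ?_ (Metric.closedBall x0 ρ)
    (isCompact_closedBall x0 ρ) ?_ ?_ ?_ x0 t1 ht1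
  · have h1 := (hfle t1 ht1).1
    simp only [hU, sub_self, norm_zero] at hres
    norm_num at hres
    have h2 : δ ≤ m / 4 := by
      have := mul_le_mul_of_nonneg_left hqsq hm0.le
      rw [hδ]; linarith
    have : c4 / 4 * ρ ^ (-ν) = m / 4 := by rw [hm]; ring
    rw [this]; linarith
  · apply Continuous.continuousOn
    simp only [hU, hf]
    fun_prop
  · apply hv.cont.mono
    apply Set.prod_mono le_rfl
    intro t ht; exact ht0.le.trans ht.1
  · intro y hy t ht
    rw [Metric.mem_closedBall, dist_eq_norm, not_le] at hy
    rw [hout y hy.le t]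
    have := hv.nonneg y t (ht0.le.trans ht.1)
    linarith
  · intro y
    rcases le_total ρ ‖y - x0‖ with hy | hy
    · rw [hout y hy]
      have := hv.nonneg y t0 ht0
      linarith
    · have h1 := hmlow y hy
      have h2 := hmaxle y
      have h3 : f t0 = m := by simp [hf]
      simp only [hU, h3]
      have := mul_le_mul_of_nonneg_left h2 hm0.le
      linarith
  · intro y t ht heq hle
    have htp : 0 < t := ht0.trans_lt ht.1
    have htI : t ∈ Set.Icc t0 (t0 + T) := ⟨ht.1.le, ht.2⟩
    obtain ⟨hf1, hf2⟩ := hfle t htI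
    have hvn := hv.nonneg y t htp.le
    have hin : ‖y - x0‖ < ρ := by
      by_contra hc
      push Not at hc
      rw [hout y hc t] at heq
      linarith
    set s : ℝ := ‖y - x0‖ ^ 2 / ρ ^ 2 with hs
    have hs0 : 0 ≤ s := by positivity
    have hs1 : s < 1 := by
      rw [hs, div_lt_one (by positivity)]
      exact pow_lt_pow_left₀ hin (norm_nonneg _) (by norm_num)
    have hsρ : ‖y - x0‖ ^ 2 = s * ρ ^ 2 := by rw [hs]; field_simp
    have hmx : max 0 (1 - s) = 1 - s := max_eq_right (by linarith)
    have hUy : ∀ τ, U y τ = f τ * (1 - s) ^ 2 - δ := by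
      intro τ; simp only [hU, ← hs, hmx]
    -- Laplacian
    have hlap := lap_ge_of_touch n (fun z => v z t) (hv.smooth_space t htp) y x0
      (fun R => f t * (1 - R / ρ ^ 2) ^ 2 - δ)
      (fun R => f t * (2 * (1 - R / ρ ^ 2) * (-(1 / ρ ^ 2))))
      (f t * (2 * (-(1 / ρ ^ 2)) * (-(1 / ρ ^ 2)))) ?_ ?_ ?_ ?_
    · have htime := deriv_le_of_touch_left (fun τ => v y τ ^ p) (fun τ => U y τ ^ p) t0 t
        (deriv (fun τ => v y τ ^ p) t)
        ((m * (-(1 / (2 * T))) * (1 - s) ^ 2) * p * (U y t) ^ (p - 1)) ht.1 ?_ ?_ ?_ ?_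
      · rw [hv.pde y t htp] at htime
        have hvp : 0 ≤ v y t ^ p := Real.rpow_nonneg hvn p
        rw [heq] at htime
        rw [hsρ] at hlap
        have hlap2 : f t / ρ ^ 2 * (8 * s - 4 * n * (1 - s)) ≤ lap n (fun z => v z t) y := by
          refine le_trans (le_of_eq ?_) hlap
          field_simp
          ring
        have hvv : 0 ≤ v y t ^ (p - 1) := Real.rpow_nonneg hvn _
        have hmain : m * (1 / (2 * T)) * (1 - s) ^ 2 * p * v y t ^ (p - 1) ≤
            f t / ρ ^ 2 * (4 * n * (1 - s) - 8 * s) := by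
          have g1 : m * (-(1 / (2 * T))) * (1 - s) ^ 2 * p * v y t ^ (p - 1) =
            -(m * (1 / (2 * T)) * (1 - s) ^ 2 * p * v y t ^ (p - 1)) := by ring
          have g2 : f t / ρ ^ 2 * (4 * n * (1 - s) - 8 * s) =
            -(f t / ρ ^ 2 * (8 * s - 4 * n * (1 - s))) := by ring
          rw [g1] at htime
          rw [g2]
          linarith
        have hf0 : 0 < f t := by linarith
        have h0 : 0 ≤ m * (1 / (2 * T)) * (1 - s) ^ 2 * p * v y t ^ (p - 1) := by positivity
        have h1 : 0 ≤ 4 * (n:ℝ) * (1 - s) - 8 * s := by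
          have : 0 < f t / ρ ^ 2 := by positivity
          exact nonneg_of_mul_nonneg_right (h0.trans hmain) this
        have hsq : q ≤ 1 - s := by
          rw [hq, div_le_iff₀ (by positivity)]
          linarith
        have hsq2 : q ^ 2 ≤ (1 - s) ^ 2 := pow_le_pow_left₀ hq0.le hsq 2
        have hvlow : m * q ^ 2 / 4 ≤ v y t := by
          rw [← heq, hUy t, hδ]
          have := mul_le_mul hf1 hsq2 (by positivity) hf0.le
          linarith
        have hvlow2 : (m * q ^ 2 / 4) ^ (p - 1) ≤ v y t ^ (p - 1) :=
          Real.rpow_le_rpow (by positivity) hvlow (by linarith)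
        have e1 : (m * q ^ 2 / 4) ^ (p - 1) * ρ ^ 2 = (c4 * q ^ 2 / 4) ^ (p - 1) := by
          have a1 : m * q ^ 2 / 4 = m * (q ^ 2 / 4) := by ring
          have a2 : c4 * q ^ 2 / 4 = c4 * (q ^ 2 / 4) := by ring
          have a3 : 0 ≤ q ^ 2 / 4 := by positivity
          rw [a1, a2, Real.mul_rpow hm0.le a3, Real.mul_rpow hc40.le a3]
          calc _ = (m ^ (p - 1) * ρ ^ 2) * (q ^ 2 / 4) ^ (p - 1) := by ring
            _ = _ := by rw [hmρ]
        have hl : m * (1 / (2 * T)) * q ^ 2 * p * (m * q ^ 2 / 4) ^ (p - 1) ≤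
            m * (1 / (2 * T)) * (1 - s) ^ 2 * p * v y t ^ (p - 1) := by
          gcongr
        have hr : f t / ρ ^ 2 * (4 * n * (1 - s) - 8 * s) ≤ m / ρ ^ 2 * (4 * n) := by
          apply mul_le_mul _ _ _ (by positivity)
          · exact div_le_div_of_nonneg_right hf2 (by positivity)
          · have : 0 ≤ (n : ℝ) * s := mul_nonneg (by positivity) hs0
            linarith
          · exact h1
        have hfin := (hl.trans hmain).trans hr
        set X := (m * q ^ 2 / 4) ^ (p - 1) with hX
        have hfin2 : p * q ^ 2 * (X * ρ ^ 2) ≤ 8 * n * T := by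
          have h5 := mul_le_mul_of_nonneg_left hfin (show 0 ≤ 2 * T * ρ ^ 2 / m by positivity)
          have e2 : 2 * T * ρ ^ 2 / m * (m * (1 / (2 * T)) * q ^ 2 * p * X) =
              p * q ^ 2 * (X * ρ ^ 2) := by field_simp
          have e3 : 2 * T * ρ ^ 2 / m * (m / ρ ^ 2 * (4 * n)) = 8 * n * T := by
            field_simp; ring
          rw [e2, e3] at h5
          exact h5
        rw [e1] at hfin2
        have e4 : 16 * n * T = p * q ^ 2 * (c4 * q ^ 2 / 4) ^ (p - 1) := by
          rw [hT]; field_simp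
        have : 0 < 8 * n * T := by positivity
        linarith
      · exact ((hv.smooth_time y).contDiffAt (Ioi_mem_nhds htp)).differentiableAt
          (by norm_num) |>.hasDerivAt
      · have h1 : HasDerivAt (fun τ => U y τ) (m * (-(1 / (2 * T))) * (1 - s) ^ 2) t := by
          simp only [hUy, hf]
          have := (((((hasDerivAt_id t).sub_const t0).div_const (2 * T)).const_sub 1).const_mul m)
          exact (this.mul_const ((1 - s) ^ 2)).sub_const δ
        exact h1.rpow_const (Or.inr hp.le)
      · intro τ hτ
        apply Real.rpow_le_rpow _ (hle y τ hτ) (by linarith)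
        rw [← heq, hUy] at hvn
        rw [hUy]
        have : f t ≤ f τ := by
          simp only [hf]
          apply mul_le_mul_of_nonneg_left _ hm0.le
          have : (τ - t0) / (2 * T) ≤ (t - t0) / (2 * T) :=
            div_le_div_of_nonneg_right (by linarith [hτ.2]) (by positivity)
          linarith
        have := mul_le_mul_of_nonneg_right this (sq_nonneg (1 - s))
        linarith
      · simp only [heq]
    · refine Filter.Eventually.of_forall fun R => ?_
      have h1 := (((hasDerivAt_id R).div_const (ρ ^ 2)).const_sub 1).pow 2
      refine HasDerivAt.congr_deriv ((h1.const_mul (f t)).sub_const δ) ?_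
      simp
    · have h1 := (((hasDerivAt_id (‖y - x0‖ ^ 2)).div_const (ρ ^ 2)).const_sub 1)
      exact ((h1.const_mul 2).mul_const (-(1 / ρ ^ 2))).const_mul (f t)
    · have hnear : ∀ᶠ z in nhds y, ‖z - x0‖ < ρ := by
        have hc : Continuous fun z : EuclideanSpace ℝ (Fin n) => ‖z - x0‖ := by fun_prop
        exact hc.continuousAt.eventually (gt_mem_nhds hin)
      filter_upwards [hnear] with z hz
      have h1 := hle z t ⟨ht.1.le, le_rfl⟩
      have h2 : max 0 (1 - ‖z - x0‖ ^ 2 / ρ ^ 2) = 1 - ‖z - x0‖ ^ 2 / ρ ^ 2 := by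
        apply max_eq_right
        rw [sub_nonneg, div_le_one (by positivity)]
        exact pow_le_pow_left₀ (norm_nonneg _) hz.le 2
      simp only [hU, h2] at h1
      exact h1
    · simp only [← hs]
      rw [← hUy t]; exact heq

lemma rpow_tangent (p a b : ℝ) (hp : 1 < p) (ha : 0 < a) (hb : 0 ≤ a + b) :
    a ^ p + p * a ^ (p - 1) * b ≤ (a + b) ^ p := by
  have h1 : 1 + p * (b / a) ≤ (1 + b / a) ^ p := by
    apply one_add_mul_self_le_rpow_one_add _ hp.le
    rw [le_div_iff₀ ha]; linarith
  have e1 : a + b = a * (1 + b / a) := by field_simp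
  have h2 : 0 ≤ 1 + b / a := by
    have : 1 + b / a = (a + b) / a := by field_simp
    rw [this]; positivity
  rw [e1, Real.mul_rpow ha.le h2]
  have e2 : a ^ (p - 1) = a ^ p / a := by rw [Real.rpow_sub ha, Real.rpow_one]
  have e3 : a ^ p + p * a ^ (p - 1) * b = a ^ p * (1 + p * (b / a)) := by
    rw [e2]; field_simp
  rw [e3]
  exact mul_le_mul_of_nonneg_left h1 (by positivity)

lemma touch_alg (p κ f w v η c1 lm : ℝ) (hp : 1 < p) (hκ : 0 < κ) (hf : 0 < f) (hw : 0 ≤ w)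
    (hv : 0 < v) (hη : 0 < η) (hvu : v = f + w - η) (hc1 : 0 < c1) (hc : c1 * (f + w) ≤ v)
    (hlm : 1 + p * κ < lm * c1 ^ (p - 1))
    (h : -f ^ p - (1 + κ) * p * f ^ (p - 1) * w + v ^ p ≤
      (-κ * w - lm * η) * p * v ^ (p - 1)) : False := by
  obtain ⟨u, hu⟩ : ∃ u, u = f + w := ⟨_, rfl⟩
  have hu0 : 0 < u := by linarith
  have hp0 : 0 < p := by linarith
  have b1 := rpow_tangent p f w hp hf (by linarith)
  rw [← hu] at b1 hc
  have b2 : f ^ (p - 1) ≤ u ^ (p - 1) := Real.rpow_le_rpow hf.le (by linarith) (by linarith)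
  have b3 := rpow_tangent p u (v - u) hp hu0 (by linarith)
  rw [add_sub_cancel] at b3
  have b3' : v ≤ u := by linarith
  have b4 : v ^ (p - 1) ≤ u ^ (p - 1) := Real.rpow_le_rpow hv.le b3' (by linarith)
  have b5 : c1 ^ (p - 1) * u ^ (p - 1) ≤ v ^ (p - 1) := by
    rw [← Real.mul_rpow hc1.le hu0.le]
    exact Real.rpow_le_rpow (by positivity) hc (by linarith)
  have eu : u ^ p = u ^ (p - 1) * u := by
    rw [← Real.rpow_add_one hu0.ne']; ring_nf
  have ev : v ^ p = v ^ (p - 1) * v := by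
    rw [← Real.rpow_add_one hv.ne']; ring_nf
  have hvη : v - u = -η := by linarith
  rw [hvη] at b3
  have hX : 0 < u ^ (p - 1) := by positivity
  have hV : 0 < v ^ (p - 1) := by positivity
  -- (X - V) w ≤ u^p - v^p
  have c4 : (u ^ (p - 1) - v ^ (p - 1)) * w ≤ u ^ p - v ^ p := by
    have s1 : (u ^ (p - 1) - v ^ (p - 1)) * w ≤ (u ^ (p - 1) - v ^ (p - 1)) * u :=
      mul_le_mul_of_nonneg_left (by linarith) (by linarith)
    have s2 : v ^ (p - 1) * v ≤ v ^ (p - 1) * u := mul_le_mul_of_nonneg_left b3' hV.le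
    rw [eu, ev]; linarith
  have c5 : u ^ p - v ^ p ≤ p * u ^ (p - 1) * η := by linarith
  have c6 : κ * p * (f ^ (p - 1) * w) ≤ κ * p * (u ^ (p - 1) * w) := by
    apply mul_le_mul_of_nonneg_left _ (by positivity)
    exact mul_le_mul_of_nonneg_right b2 hw
  have c7 : κ * p * ((u ^ (p - 1) - v ^ (p - 1)) * w) ≤ κ * p * (p * u ^ (p - 1) * η) :=
    mul_le_mul_of_nonneg_left (c4.trans c5) (by positivity)
  have hlm0 : 0 < lm := by
    have : 0 < lm * c1 ^ (p - 1) := by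
      have : 0 < p * κ := by positivity
      linarith
    exact pos_of_mul_pos_left this (by positivity)
  have c8 : (1 + p * κ) * (p * u ^ (p - 1) * η) < lm * c1 ^ (p - 1) * (p * u ^ (p - 1) * η) :=
    mul_lt_mul_of_pos_right hlm (by positivity)
  have c9 : lm * (p * η) * (c1 ^ (p - 1) * u ^ (p - 1)) ≤ lm * (p * η) * v ^ (p - 1) :=
    mul_le_mul_of_nonneg_left b5 (by positivity)
  linarith

lemma lap_touch_u (n : ℕ) (hn : 10 < n) (p α κ γ : ℝ) (hp : 1 < p) (hκ : 0 < κ) (φ : ℝ → ℝ) (a : ℝ)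
    (hφ : IsSteadyStateA n p α φ a)
    (rm A δ c l L : ℝ) (hrm : 1 ≤ rm)
    (hpos : ∀ r ≥ rm, 0 < r ^ (-γ) - A * r ^ (-(γ + δ)))
    (hmax : ∀ r > 0, r ^ (-γ) - A * r ^ (-(γ + δ)) ≤ rm ^ (-γ) - A * rm ^ (-(γ + δ)))
    (hsub : ∀ r ≥ rm, γ * ((n:ℝ) - 2 - γ) * r ^ (-γ - 2)
        - A * ((γ + δ) * ((n:ℝ) - 2 - (γ + δ)) * r ^ (-(γ + δ) - 2))
        ≤ γ * ((n:ℝ) - 2 - γ) * (r ^ (-2 : ℝ) * (1 - c * r ^ (-l))) *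
          (r ^ (-γ) - A * r ^ (-(γ + δ))))
    (hK : (1 + κ) * p * L ^ (p - 1) = γ * ((n : ℝ) - 2 - γ))
    (hfar : ∀ r ≥ rm, L ^ (p - 1) * r ^ (-2 : ℝ) * (1 - c * r ^ (-l)) ≤ φ r ^ (p - 1))
    (F : EuclideanSpace ℝ (Fin n) → ℝ) (hF : ContDiff ℝ 2 F) (w η : ℝ) (hw : 0 ≤ w)
    (x : EuclideanSpace ℝ (Fin n))
    (hle : ∀ y, φ ‖y‖ + w * ((max ‖y‖ rm) ^ (-γ) - A * (max ‖y‖ rm) ^ (-(γ + δ))) - η ≤ F y)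
    (heq : φ ‖x‖ + w * ((max ‖x‖ rm) ^ (-γ) - A * (max ‖x‖ rm) ^ (-(γ + δ))) - η = F x) :
    -φ ‖x‖ ^ p - (1 + κ) * p * φ ‖x‖ ^ (p - 1) *
      (w * ((max ‖x‖ rm) ^ (-γ) - A * (max ‖x‖ rm) ^ (-(γ + δ)))) ≤ lap n F x := by
  have hN : (11 : ℝ) ≤ n := by exact_mod_cast hn
  have hφ0 := hφ.pos ‖x‖ (norm_nonneg x)
  have hΨ := hpos (max ‖x‖ rm) (le_max_right _ _)
  rcases lt_or_ge ‖x‖ rm with hx | hx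
  · have hnear : ∀ᶠ y in nhds x, ‖y‖ < rm :=
      continuous_norm.continuousAt.eventually (gt_mem_nhds hx)
    rw [max_eq_right hx.le] at heq hΨ ⊢
    set P := rm ^ (-γ) - A * rm ^ (-(γ + δ)) with hP
    have hmain : -φ ‖x‖ ^ p ≤ lap n F x := by
      rcases (norm_nonneg x).eq_or_lt with h0 | h0
      · have hx0 : x = 0 := norm_eq_zero.1 h0.symm
        have hz := phi_near_zero n hn p α hp φ a hφ
        have h := lap_ge_of_touch n F hF x 0 (fun R => α - α ^ p * R / (2 * n) + w * P - η)
          (fun _ => - (α ^ p * 1 / (2 * n))) 0 ?_ ?_ ?_ ?_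
        · rw [← h0, hφ.val0]
          refine le_trans (le_of_eq ?_) h
          field_simp
          ring
        · refine Filter.Eventually.of_forall fun R => ?_
          exact (((((hasDerivAt_id R).const_mul (α ^ p)).div_const (2 * (n:ℝ))).const_sub
            α).add_const (w * P)).sub_const η
        · exact hasDerivAt_const _ _
        · filter_upwards [hnear] with y hy
          have h1 := hle y
          rw [max_eq_right hy.le] at h1
          have h2 := hz ‖y‖ (norm_nonneg y)
          simp only [sub_zero]
          linarith
        · rw [← h0, hφ.val0] at heq
          simp only [sub_zero, ← h0]
          norm_num
          linarith
      · have h := lap_ge_radial n F hF x h0 (fun r => φ r + w * P - η) (deriv φ)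
          (deriv (deriv φ) ‖x‖) ?_ (phi_derivs n p α φ a hφ _ h0).2 ?_ heq
        · have := hφ.ode ‖x‖ h0
          linarith
        · intro r hr
          exact ((phi_derivs n p α φ a hφ r hr).1.add_const (w * P)).sub_const η
        · filter_upwards [hnear] with y hy
          have h1 := hle y
          rwa [max_eq_right hy.le] at h1
    have : 0 ≤ (1 + κ) * p * φ ‖x‖ ^ (p - 1) * (w * P) := by positivity
    linarith
  · have h0 : 0 < ‖x‖ := by linarith
    rw [max_eq_left hx] at heq hΨ ⊢
    have h := lap_ge_radial n F hF x h0
      (fun r => φ r + w * (r ^ (-γ) - A * r ^ (-(γ + δ))) - η)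
      (fun r => deriv φ r + w * (-γ * r ^ (-γ - 1) - A * (-(γ + δ) * r ^ (-(γ + δ) - 1))))
      (deriv (deriv φ) ‖x‖ + w * (-γ * ((-γ - 1) * ‖x‖ ^ (-γ - 1 - 1)) -
        A * (-(γ + δ) * ((-(γ + δ) - 1) * ‖x‖ ^ (-(γ + δ) - 1 - 1))))) ?_ ?_ ?_ heq
    · set r := ‖x‖ with hr
      have hode := hφ.ode r h0
      have e1 : ∀ m : ℝ, r ^ (m - 1) = r ^ (m - 2) * r := by
        intro m; rw [← Real.rpow_add_one h0.ne']; ring_nf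
      have e2 : ∀ m : ℝ, r ^ (m - 1 - 1) = r ^ (m - 2) := by
        intro m; ring_nf
      rw [e1 (-γ), e1 (-(γ + δ)), e2, e2] at h
      have hs := hsub r hx
      have e3 : deriv (deriv φ) r + w * (-γ * ((-γ - 1) * r ^ (-γ - 2)) -
          A * (-(γ + δ) * ((-(γ + δ) - 1) * r ^ (-(γ + δ) - 2)))) +
          ((n:ℝ) - 1) / r * (deriv φ r + w * (-γ * (r ^ (-γ - 2) * r) -
          A * (-(γ + δ) * (r ^ (-(γ + δ) - 2) * r)))) =
          (deriv (deriv φ) r + ((n:ℝ) - 1) / r * deriv φ r) -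
          w * (γ * ((n:ℝ) - 2 - γ) * r ^ (-γ - 2)
        - A * ((γ + δ) * ((n:ℝ) - 2 - (γ + δ)) * r ^ (-(γ + δ) - 2))) := by
        field_simp
        ring
      rw [e3] at h
      set P := r ^ (-γ) - A * r ^ (-(γ + δ)) with hP
      have h1 : γ * ((n:ℝ) - 2 - γ) * (r ^ (-2 : ℝ) * (1 - c * r ^ (-l))) * P ≤
          (1 + κ) * p * φ r ^ (p - 1) * P := by
        apply mul_le_mul_of_nonneg_right _ hΨ.le
        rw [← hK]
        have := mul_le_mul_of_nonneg_left (hfar r hx) (show 0 ≤ (1 + κ) * p by positivity)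
        linarith
      have h2 := mul_le_mul_of_nonneg_left (hs.trans h1) hw
      linarith
    · intro r hr
      have a1 := Real.hasDerivAt_rpow_const (x := r) (p := -γ) (Or.inl hr.ne')
      have a2 := Real.hasDerivAt_rpow_const (x := r) (p := -(γ + δ)) (Or.inl hr.ne')
      exact ((phi_derivs n p α φ a hφ r hr).1.add
        ((a1.sub (a2.const_mul A)).const_mul w)).sub_const η
    · have a1 := Real.hasDerivAt_rpow_const (x := ‖x‖) (p := -γ - 1) (Or.inl h0.ne')
      have a2 := Real.hasDerivAt_rpow_const (x := ‖x‖) (p := -(γ + δ) - 1) (Or.inl h0.ne')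
      exact ((phi_derivs n p α φ a hφ _ h0).2.add
        (((a1.const_mul (-γ)).sub ((a2.const_mul (-(γ + δ))).const_mul A)).const_mul w))
    · have hnear : ∀ᶠ y in nhds x, 0 < ‖y‖ :=
        continuous_norm.continuousAt.eventually (lt_mem_nhds h0)
      filter_upwards [hnear] with y hy
      refine le_trans ?_ (hle y)
      have : ‖y‖ ^ (-γ) - A * ‖y‖ ^ (-(γ + δ)) ≤
          max ‖y‖ rm ^ (-γ) - A * max ‖y‖ rm ^ (-(γ + δ)) := by
        rcases le_total ‖y‖ rm with h1 | h1
        · rw [max_eq_right h1]; exact hmax _ hy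
        · rw [max_eq_left h1]
      have := mul_le_mul_of_nonneg_left this hw
      linarith

lemma compare_step (n : ℕ) (p α κ ε : ℝ) (hp : 1 < p) (hκ : 0 < κ) (hε : 0 < ε)
    (hν : 0 < nuExp p) (φ : ℝ → ℝ) (a : ℝ)
    (hφ : IsSteadyStateA n p α φ a) (Ψ : EuclideanSpace ℝ (Fin n) → ℝ) (hΨc : Continuous Ψ)
    (hΨ : ∀ x, 0 < Ψ x)
    (htouch : ∀ F : EuclideanSpace ℝ (Fin n) → ℝ, ContDiff ℝ 2 F → ∀ w η : ℝ, 0 ≤ w →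
      ∀ x, (∀ y, φ ‖y‖ + w * Ψ y - η ≤ F y) → φ ‖x‖ + w * Ψ x - η = F x →
      -φ ‖x‖ ^ p - (1 + κ) * p * φ ‖x‖ ^ (p - 1) * (w * Ψ x) ≤ lap n F x)
    (v : EuclideanSpace ℝ (Fin n) → ℝ → ℝ) (v₀ : EuclideanSpace ℝ (Fin n) → ℝ)
    (hv : IsBddClassicalSol n p v v₀) (t0 T c3 Cu : ℝ) (ht0 : 0 ≤ t0)
    (hc3 : 0 < c3) (hCu : 0 < Cu)
    (hup : ∀ x, φ ‖x‖ + ε * Ψ x ≤ Cu * (1 + ‖x‖) ^ (-nuExp p))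
    (hlow : ∀ x, ∀ t ∈ Set.Icc t0 (t0 + T), c3 * (1 + ‖x‖) ^ (-nuExp p) ≤ v x t)
    (hinit : ∀ x, φ ‖x‖ + ε * Real.exp (-κ * t0) * Ψ x ≤ v x t0) :
    ∀ x, ∀ t ∈ Set.Icc t0 (t0 + T), φ ‖x‖ + ε * Real.exp (-κ * t) * Ψ x ≤ v x t := by
  have hexp : ∀ t, 0 ≤ t → ε * Real.exp (-κ * t) ≤ ε := by
    intro t ht
    have : Real.exp (-κ * t) ≤ 1 := by
      rw [Real.exp_le_one_iff]
      have := mul_nonneg hκ.le ht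
      linarith
    nlinarith
  have hup2 : ∀ x t, 0 ≤ t → φ ‖x‖ + ε * Real.exp (-κ * t) * Ψ x ≤
      Cu * (1 + ‖x‖) ^ (-nuExp p) := by
    intro x t ht
    have := mul_le_mul_of_nonneg_right (hexp t ht) (hΨ x).le
    linarith [hup x]
  have hc1 : 0 < c3 / Cu := by positivity
  set c1 := c3 / Cu with hc1def
  set lm := (2 + p * κ) / c1 ^ (p - 1) with hlm
  have hlm0 : 0 < lm := by positivity
  have hlm1 : 1 + p * κ < lm * c1 ^ (p - 1) := by
    rw [hlm, div_mul_cancel₀ _ (by positivity)]; linarith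
  have hθ : ∀ θ > 0, ∀ x, ∀ t ∈ Set.Icc t0 (t0 + T),
      φ ‖x‖ + ε * Real.exp (-κ * t) * Ψ x - θ * Real.exp (lm * (t - t0)) < v x t := by
    intro θ hθ0
    have hdec : Tendsto (fun r : ℝ => Cu * (1 + r) ^ (-nuExp p)) atTop (nhds 0) := by
      have h1 : Tendsto (fun r : ℝ => 1 + r) atTop atTop := tendsto_atTop_add_const_left _ _ tendsto_id
      simpa using ((tendsto_rpow_neg_atTop hν).comp h1).const_mul Cu
    obtain ⟨R, hR⟩ := (hdec.eventually (gt_mem_nhds hθ0)).exists_forall_of_atTop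
    refine first_touch (fun x t => φ ‖x‖ + ε * Real.exp (-κ * t) * Ψ x -
      θ * Real.exp (lm * (t - t0))) v t0 (t0 + T) ?_ ?_ (Metric.closedBall 0 R)
      (isCompact_closedBall 0 R) ?_ ?_ ?_
    · apply Continuous.continuousOn
      have hφc : Continuous fun x : EuclideanSpace ℝ (Fin n) => φ ‖x‖ :=
        hφ.cont.comp_continuous continuous_norm fun x => norm_nonneg x
      have h1 : Continuous fun q : EuclideanSpace ℝ (Fin n) × ℝ => φ ‖q.1‖ :=
        hφc.comp continuous_fst
      have h2 : Continuous fun q : EuclideanSpace ℝ (Fin n) × ℝ => Ψ q.1 :=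
        hΨc.comp continuous_fst
      have h3 : Continuous fun q : EuclideanSpace ℝ (Fin n) × ℝ => ε * Real.exp (-κ * q.2) := by
        fun_prop
      have h4 : Continuous fun q : EuclideanSpace ℝ (Fin n) × ℝ =>
          θ * Real.exp (lm * (q.2 - t0)) := by
        fun_prop
      exact (h1.add (h3.mul h2)).sub h4
    · apply hv.cont.mono
      apply Set.prod_mono le_rfl
      intro t ht; exact ht0.trans ht.1
    · intro x hx t ht
      simp only [Metric.mem_closedBall, dist_zero_right, not_le] at hx
      have h1 := hup2 x t (ht0.trans ht.1)
      have h2 := hR ‖x‖ hx.le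
      have h3 := hv.nonneg x t (ht0.trans ht.1)
      have h4 : 1 ≤ Real.exp (lm * (t - t0)) :=
        Real.one_le_exp (mul_nonneg hlm0.le (by linarith [ht.1]))
      have h5 : θ * 1 ≤ θ * Real.exp (lm * (t - t0)) := mul_le_mul_of_nonneg_left h4 hθ0.le
      linarith
    · intro x
      have := hinit x
      simp only [sub_self, mul_zero, Real.exp_zero]
      linarith
    · intro x t ht heq hle
      have htp : 0 < t := ht0.trans_lt ht.1
      have htI : t ∈ Set.Icc t0 (t0 + T) := ⟨ht.1.le, ht.2⟩
      have hw0 : 0 < ε * Real.exp (-κ * t) := by positivity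
      have hη0 : 0 < θ * Real.exp (lm * (t - t0)) := by positivity
      have hvl := hlow x t htI
      have hu := hup2 x t htp.le
      have hr0 : 0 < (1 + ‖x‖) ^ (-nuExp p) := by positivity
      have hv0 : 0 < v x t := lt_of_lt_of_le (by positivity) hvl
      have hlap := htouch (fun z => v z t) (hv.smooth_space t htp) _ _ hw0.le x
        (fun y => hle y t ⟨ht.1.le, le_rfl⟩) heq
      have hUd : HasDerivAt (fun τ => φ ‖x‖ + ε * Real.exp (-κ * τ) * Ψ x -
          θ * Real.exp (lm * (τ - t0))) (-κ * (ε * Real.exp (-κ * t) * Ψ x) -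
          lm * (θ * Real.exp (lm * (t - t0)))) t := by
        have a1 := (((hasDerivAt_id t).const_mul (-κ)).exp.const_mul ε).mul_const (Ψ x)
        have a2 := ((((hasDerivAt_id t).sub_const t0).const_mul lm).exp.const_mul θ)
        refine HasDerivAt.congr_deriv ((a1.const_add (φ ‖x‖)).sub a2) ?_
        simp only [id]
        ring
      have hUp := hUd.rpow_const (p := p) (Or.inr hp.le)
      have hvd : HasDerivAt (fun τ => v x τ ^ p) (deriv (fun τ => v x τ ^ p) t) t :=
        (((hv.smooth_time x).contDiffAt (Ioi_mem_nhds htp)).differentiableAt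
          (by norm_num)).hasDerivAt
      obtain ⟨t2, ht2, ht2t, hpos2⟩ : ∃ t2, t0 ≤ t2 ∧ t2 < t ∧ ∀ τ ∈ Set.Icc t2 t,
          0 ≤ φ ‖x‖ + ε * Real.exp (-κ * τ) * Ψ x - θ * Real.exp (lm * (τ - t0)) := by
        have hev := hUd.continuousAt.eventually (lt_mem_nhds (heq ▸ hv0))
        obtain ⟨d, hd, hball⟩ := Metric.eventually_nhds_iff.1 hev
        refine ⟨max t0 (t - d / 2), le_max_left _ _, max_lt ht.1 (by linarith), ?_⟩
        intro τ hτ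
        refine (hball ?_).le
        rw [Real.dist_eq, abs_lt]
        have := (le_max_right _ _).trans hτ.1
        constructor <;> linarith [hτ.2]
      have htime := deriv_le_of_touch_left _ _ t2 t _ _ ht2t hvd hUp
        (fun τ hτ => Real.rpow_le_rpow (hpos2 τ hτ) (hle x τ ⟨ht2.trans hτ.1, hτ.2⟩) (by linarith))
        (by simp only [heq])
      rw [hv.pde x t htp] at htime
      refine touch_alg p κ (φ ‖x‖) (ε * Real.exp (-κ * t) * Ψ x) (v x t)
        (θ * Real.exp (lm * (t - t0))) c1 lm hp hκ (hφ.pos _ (norm_nonneg x))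
        (mul_nonneg hw0.le (hΨ x).le) hv0 hη0 heq.symm hc1 ?_ hlm1 ?_
      · refine le_trans ?_ hvl
        have := mul_le_mul_of_nonneg_left hu hc1.le
        refine this.trans (le_of_eq ?_)
        rw [hc1def]; field_simp
      · rw [heq] at htime
        linarith
  intro x t ht
  have hE : 0 < Real.exp (lm * (t - t0)) := Real.exp_pos _
  apply le_of_forall_pos_le_add
  intro e he
  have := hθ (e / Real.exp (lm * (t - t0))) (by positivity) x t ht
  rw [div_mul_cancel₀ _ hE.ne'] at this
  linarith

/-- Theorem 1.2(i): let `n > 10`, `p > p_c`, `α > 0`, `b > 0` and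
`γ ∈ (ν+λ₁, (n−2)/2)`. If `v₀` is continuous with `v₀(x) ≥ φ_α(|x|) + b(|x|+1)^{−γ}`
for all `x`, then every bounded classical solution `v` with initial data `v₀` satisfies
`v(0,t) − φ_α(0) ≥ C e^{−κ(γ)t}` for some `C > 0`. -/
theorem lower_rate_from_above_full_space (n : ℕ) (hn : 10 < n) (p α b γ : ℝ)
    (hp : pc n < p) (hα : 0 < α) (hb : 0 < b)
    (hγ : γ ∈ Set.Ioo (nuExp p + lam1 n p) (((n : ℝ) - 2) / 2))
    (φ : ℝ → ℝ) (a : ℝ) (hφ : IsSteadyStateA n p α φ a)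
    (v₀ : EuclideanSpace ℝ (Fin n) → ℝ) (hv₀cont : Continuous v₀)
    (hv₀lower : ∀ x : EuclideanSpace ℝ (Fin n),
      φ ‖x‖ + b * (‖x‖ + 1) ^ (-γ) ≤ v₀ x)
    (v : EuclideanSpace ℝ (Fin n) → ℝ → ℝ) (hv : IsBddClassicalSol n p v v₀) :
    ∃ C > 0, ∀ t ≥ (0 : ℝ),
      C * Real.exp (-(kappaOf n p γ) * t) ≤ v 0 t - φ 0 := by
  obtain ⟨hp1, hν, hlam, hL, hνγ, hνp, hκ, hK⟩ := params n hn p γ hp hγ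
  have hγ0 : 0 < γ := hν.trans hνγ
  obtain ⟨R0, hR0, c, hc, hfar⟩ := phi_far n p α φ a hφ hp1 hνp hlam hL
  obtain ⟨rm, hrm, A, hA, δ, hδ, hpos, hmax, hsub⟩ :=
    exists_psi n γ R0 c (lam1 n p) hγ0 hγ.2 hR0 hc hlam
  have hrm1 : 1 ≤ rm := hR0.trans hrm
  obtain ⟨c2, hc2, hlow⟩ := phi_lower n p α φ a hφ hp1 hν hνp hlam hL
  obtain ⟨Cφ, hCφ, hupp⟩ := phi_upper n p α φ a hφ hν hL
  obtain ⟨T, hT, c3, hc3, hpers⟩ := persist n hn p hp1 hν hνp c2 hc2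
  set κ := kappaOf n p γ with hκdef
  obtain ⟨Ψ, hΨdef⟩ : ∃ Ψ : EuclideanSpace ℝ (Fin n) → ℝ,
      Ψ = fun x => (max ‖x‖ rm) ^ (-γ) - A * (max ‖x‖ rm) ^ (-(γ + δ)) := ⟨_, rfl⟩
  have hm0 : ∀ x : EuclideanSpace ℝ (Fin n), 0 < max ‖x‖ rm := fun x =>
    lt_of_lt_of_le (by linarith) (le_max_right _ _)
  have hΨc : Continuous Ψ := by
    rw [hΨdef]
    have hm : Continuous fun x : EuclideanSpace ℝ (Fin n) => max ‖x‖ rm :=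
      continuous_norm.max continuous_const
    exact (hm.rpow_const fun x => Or.inl (hm0 x).ne').sub
      (continuous_const.mul (hm.rpow_const fun x => Or.inl (hm0 x).ne'))
  have hΨ : ∀ x, 0 < Ψ x := by
    intro x; rw [hΨdef]; exact hpos _ (le_max_right _ _)
  have hΨup : ∀ x, Ψ x ≤ 2 ^ γ * (1 + ‖x‖) ^ (-γ) := by
    intro x
    have hn0 := norm_nonneg x
    have h1 : (1 + ‖x‖) / 2 ≤ max ‖x‖ rm := by
      rcases le_total ‖x‖ 1 with h | h
      · exact le_trans (by linarith) (hrm1.trans (le_max_right _ _))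
      · exact le_trans (by linarith) (le_max_left _ _)
    have h2 : (max ‖x‖ rm) ^ (-γ) ≤ ((1 + ‖x‖) / 2) ^ (-γ) :=
      Real.rpow_le_rpow_of_nonpos (by positivity) h1 (by linarith)
    have h3 : ((1 + ‖x‖) / 2) ^ (-γ) = 2 ^ γ * (1 + ‖x‖) ^ (-γ) := by
      rw [Real.div_rpow (by positivity) (by norm_num), Real.rpow_neg (by norm_num : (0:ℝ) ≤ 2)]
      field_simp
    have h4 : 0 ≤ A * (max ‖x‖ rm) ^ (-(γ + δ)) :=
      mul_nonneg hA.le (Real.rpow_nonneg (hm0 x).le _)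
    rw [hΨdef]
    simp only
    linarith
  have h2γ : (0:ℝ) < 2 ^ γ := by positivity
  obtain ⟨ε, hεdef⟩ : ∃ ε, ε = b / 2 ^ γ := ⟨_, rfl⟩
  have hε : 0 < ε := by rw [hεdef]; positivity
  have hεΨ : ∀ x, ε * Ψ x ≤ b * (1 + ‖x‖) ^ (-γ) := by
    intro x
    refine (mul_le_mul_of_nonneg_left (hΨup x) hε.le).trans (le_of_eq ?_)
    rw [hεdef]; field_simp
  have hup : ∀ x, φ ‖x‖ + ε * Ψ x ≤ (Cφ + b) * (1 + ‖x‖) ^ (-nuExp p) := by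
    intro x
    have h1 : (1 + ‖x‖) ^ (-γ) ≤ (1 + ‖x‖) ^ (-nuExp p) :=
      Real.rpow_le_rpow_of_exponent_le (by linarith [norm_nonneg x]) (by linarith)
    have h2 := mul_le_mul_of_nonneg_left h1 hb.le
    have h3 := hεΨ x
    have h4 := hupp ‖x‖ (norm_nonneg x)
    linarith
  have hinit0 : ∀ x, φ ‖x‖ + ε * Real.exp (-κ * 0) * Ψ x ≤ v x 0 := by
    intro x
    have h1 := hv₀lower x
    have h2 := hεΨ x
    rw [hv.init, mul_zero, Real.exp_zero, mul_one]
    rw [add_comm ‖x‖ 1] at h1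
    linarith
  have step : ∀ t0, 0 ≤ t0 → (∀ x, φ ‖x‖ + ε * Real.exp (-κ * t0) * Ψ x ≤ v x t0) →
      ∀ x, ∀ t ∈ Set.Icc t0 (t0 + T), φ ‖x‖ + ε * Real.exp (-κ * t) * Ψ x ≤ v x t := by
    intro t0 ht0 h0
    refine compare_step n p α κ ε hp1 hκ hε hν φ a hφ Ψ hΨc hΨ ?_ v v₀ hv t0 T c3 (Cφ + b)
      ht0 hc3 (by positivity) hup ?_ h0
    · intro F hF w η hw x hle heq
      rw [hΨdef] at hle heq ⊢
      exact lap_touch_u n hn p α κ γ hp1 hκ φ a hφ rm A δ c (lam1 n p) (Lconst n p) hrm1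
        hpos hmax hsub hK (fun r hr => (hfar r (hrm.trans hr)).2) F hF w η hw x hle heq
    · refine hpers v v₀ hv t0 ht0 ?_
      intro x
      have h1 := hlow ‖x‖ (norm_nonneg x)
      have h2 : 0 ≤ ε * Real.exp (-κ * t0) * Ψ x :=
        mul_nonneg (mul_nonneg hε.le (Real.exp_pos _).le) (hΨ x).le
      linarith [h0 x]
  have iter : ∀ k : ℕ, ∀ x, φ ‖x‖ + ε * Real.exp (-κ * (k * T)) * Ψ x ≤ v x (k * T) := by
    intro k
    induction k with
    | zero => simpa using hinit0
    | succ k ih =>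
      intro x
      have := step (k * T) (by positivity) ih x (((k + 1 : ℕ) : ℝ) * T)
        ⟨by push_cast; nlinarith, by push_cast; linarith⟩
      exact this
  refine ⟨ε * Ψ 0, mul_pos hε (hΨ 0), ?_⟩
  intro t ht
  have hk1 := Nat.floor_le (div_nonneg ht hT.le)
  have hk2 := (Nat.lt_floor_add_one (t / T)).le
  rw [le_div_iff₀ hT] at hk1
  rw [div_le_iff₀ hT] at hk2
  have := step (⌊t / T⌋₊ * T) (by positivity) (iter _) 0 t ⟨hk1, by linarith⟩
  rw [norm_zero] at this
  linarith
end
end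

section
/- Let n > 10 be an integer, p > p_c, α > 0, b > 0 and γ ∈ (ν+λ₁, (n−2)/2). Suppose v₀ : ℝⁿ → ℝ is continuous, nonnegative, and v₀(x) ≤ φ_α(|x|) − b(|x|+1)^{−γ} for all x ∈ ℝⁿ. Then for every bounded classical solution v of (v^p)_t = Δv + v^p on ℝⁿ with initial data v₀ there exists C > 0 such that φ_α(0) − v(0,t) ≥ C e^{−κ(γ) t} for all t ≥ 0. -/
noncomputable section

open Real Filter Set Asymptotics

section helpers

lemma aux_second_deriv {k k1 : ℝ → ℝ} {k2 : ℝ} (h1 : ∀ᶠ s in nhds (0:ℝ), HasDerivAt k (k1 s) s)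
    (h2 : HasDerivAt k1 k2 0) (hmin : IsLocalMin k 0) : 0 ≤ k2 := by
  by_contra hneg
  push Not at hneg
  have hd : deriv k =ᶠ[nhds 0] k1 := h1.mono fun s hs => hs.deriv
  have hdd : deriv (deriv k) 0 = k2 := by rw [hd.deriv_eq]; exact h2.deriv
  have hmax : IsLocalMax k 0 :=
    isLocalMax_of_deriv_deriv_neg (by rw [hdd]; exact hneg) hmin.deriv_eq_zero
      h1.self_of_nhds.continuousAt
  have hconst : k =ᶠ[nhds 0] fun _ => k 0 := by
    filter_upwards [hmin, hmax] with s a b using le_antisymm b a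
  have h3 : deriv k =ᶠ[nhds 0] fun _ => 0 := by
    have := hconst.deriv
    simpa using this
  have : deriv (deriv k) 0 = 0 := by rw [h3.deriv_eq]; simp
  linarith

lemma aux_left_deriv {k : ℝ → ℝ} {k' t : ℝ} (h : HasDerivAt k k' t)
    (hk : ∀ᶠ s in nhdsWithin t (Iio t), k t ≤ k s) : k' ≤ 0 := by
  have h1 := (hasDerivWithinAt_iff_tendsto_slope' (s := Iio t) (by simp)).1 h.hasDerivWithinAt
  refine le_of_tendsto h1 ?_
  filter_upwards [hk, self_mem_nhdsWithin] with s hs hst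
  rw [slope_def_field]
  exact div_nonpos_of_nonneg_of_nonpos (by linarith) (by simp at hst; linarith)

lemma aux_tangent {p x y : ℝ} (hp : 1 < p) (hx : 0 < x) (hy : 0 < y) :
    y ^ p + p * y ^ (p - 1) * (x - y) ≤ x ^ p := by
  have h := one_add_mul_self_le_rpow_one_add (s := x / y - 1) (by have := div_pos hx hy; linarith)
    hp.le
  have e : x ^ p = y ^ p * (1 + (x / y - 1)) ^ p := by
    rw [← mul_rpow hy.le (by have := div_pos hx hy; linarith)]
    congr 1; field_simp; ring
  have e2 : y ^ p = y ^ (p - 1) * y := by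
    rw [← rpow_add_one hy.ne']; congr 1; ring
  have := mul_le_mul_of_nonneg_left h (rpow_pos_of_pos hy p).le
  rw [← e] at this
  refine le_trans (le_of_eq ?_) this
  rw [e2]; field_simp

lemma aux_lap_sq {n : ℕ} {f : EuclideanSpace ℝ (Fin n) → ℝ} (hf : ContDiff ℝ 2 f)
    (x : EuclideanSpace ℝ (Fin n)) {F F1 : ℝ → ℝ} {F2 : ℝ}
    (h1 : ∀ᶠ s in nhds (‖x‖ ^ 2), HasDerivAt F (F1 s) s) (h2 : HasDerivAt F1 F2 (‖x‖ ^ 2))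
    (hle : ∀ᶠ y in nhds x, f y ≤ F (‖y‖ ^ 2)) (heq : f x = F (‖x‖ ^ 2)) :
    lap n f x ≤ 4 * ‖x‖ ^ 2 * F2 + 2 * n * F1 (‖x‖ ^ 2) := by
  have key : ∀ i : Fin n, fderiv ℝ (fun y => fderiv ℝ f y (EuclideanSpace.single i 1)) x
    (EuclideanSpace.single i 1) ≤ 4 * (x i) ^ 2 * F2 + 2 * F1 (‖x‖ ^ 2) := by
    intro i
    set e : EuclideanSpace ℝ (Fin n) := EuclideanSpace.single i 1 with he
    have hnorm : ∀ s : ℝ, ‖x + s • e‖ ^ 2 = ‖x‖ ^ 2 + 2 * s * x i + s ^ 2 := by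
      intro s
      rw [norm_add_sq_real, inner_smul_right, norm_smul, he, EuclideanSpace.inner_single_right]
      simp
      ring
    have hline : ∀ s : ℝ, HasDerivAt (fun s : ℝ => x + s • e) e s := by
      intro s
      simpa using ((hasDerivAt_id s).smul_const e).const_add x
    have hq : ∀ s : ℝ, HasDerivAt (fun s : ℝ => ‖x‖ ^ 2 + 2 * s * x i + s ^ 2)
        (2 * x i + 2 * s) s := by
      intro s
      have := ((((hasDerivAt_id s).const_mul 2).mul_const (x i)).const_add (‖x‖ ^ 2)).add
        ((hasDerivAt_id s).pow 2)
      refine HasDerivAt.congr_deriv this ?_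
      simp
    have hq0 : Tendsto (fun s : ℝ => ‖x‖ ^ 2 + 2 * s * x i + s ^ 2) (nhds 0) (nhds (‖x‖ ^ 2)) := by
      have := (hq 0).continuousAt.tendsto
      simpa using this
    have hdf : ∀ y, HasFDerivAt f (fderiv ℝ f y) y := fun y =>
      (hf.differentiable (by norm_num)).differentiableAt.hasFDerivAt
    have hdf2 : Differentiable ℝ (fun y => fderiv ℝ f y e) := by
      have : ContDiff ℝ 1 (fderiv ℝ f) := hf.fderiv_right (by norm_num)
      exact (this.clm_apply contDiff_const).differentiable (by norm_num)
    have hk1 : ∀ᶠ s in nhds (0:ℝ), HasDerivAt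
        (fun s : ℝ => F (‖x‖ ^ 2 + 2 * s * x i + s ^ 2) - f (x + s • e))
        (F1 (‖x‖ ^ 2 + 2 * s * x i + s ^ 2) * (2 * x i + 2 * s) - fderiv ℝ f (x + s • e) e) s := by
      filter_upwards [hq0.eventually h1] with s hs
      exact (hs.comp s (hq s)).sub ((hdf _).comp_hasDerivAt s (hline s))
    have hk2 : HasDerivAt (fun s : ℝ =>
        F1 (‖x‖ ^ 2 + 2 * s * x i + s ^ 2) * (2 * x i + 2 * s) - fderiv ℝ f (x + s • e) e)
        (F2 * (2 * x i) * (2 * x i) + F1 (‖x‖ ^ 2) * 2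
          - fderiv ℝ (fun y => fderiv ℝ f y e) x e) 0 := by
      have a1 : HasDerivAt (fun s : ℝ => F1 (‖x‖ ^ 2 + 2 * s * x i + s ^ 2))
          (F2 * (2 * x i + 2 * 0)) 0 := by
        refine HasDerivAt.comp (h₂ := F1) (0:ℝ) ?_ (hq 0)
        simpa using h2
      have a2 : HasDerivAt (fun s : ℝ => 2 * x i + 2 * s) 2 0 := by
        simpa using ((hasDerivAt_id (0:ℝ)).const_mul 2).const_add (2 * x i)
      have a3 : HasDerivAt (fun s : ℝ => fderiv ℝ f (x + s • e) e)
          (fderiv ℝ (fun y => fderiv ℝ f y e) x e) 0 := by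
        have h0 : HasFDerivAt (fun y => fderiv ℝ f y e) (fderiv ℝ (fun y => fderiv ℝ f y e) x)
          (x + (0:ℝ) • e) := by
          rw [zero_smul, add_zero]; exact hdf2.differentiableAt.hasFDerivAt
        exact h0.comp_hasDerivAt (0:ℝ) (hline 0)
      have := (a1.mul a2).sub a3
      refine HasDerivAt.congr_deriv this ?_
      simp
    have hmin : IsLocalMin (fun s : ℝ => F (‖x‖ ^ 2 + 2 * s * x i + s ^ 2) - f (x + s • e)) 0 := by
      have hc : Tendsto (fun s : ℝ => x + s • e) (nhds 0) (nhds x) := by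
        have := (hline 0).continuousAt.tendsto
        simpa using this
      filter_upwards [hc.eventually hle] with s hs
      rw [hnorm] at hs
      simp only [mul_zero, zero_mul, add_zero, zero_smul, ne_eq, OfNat.ofNat_ne_zero,
        not_false_eq_true, zero_pow]
      linarith
    have := aux_second_deriv hk1 hk2 hmin
    nlinarith
  have hs : ‖x‖ ^ 2 = ∑ i, (x i) ^ 2 := by
    rw [EuclideanSpace.norm_sq_eq]; simp
  calc lap n f x ≤ ∑ i : Fin n, (4 * (x i) ^ 2 * F2 + 2 * F1 (‖x‖ ^ 2)) :=
        Finset.sum_le_sum fun i _ => key i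
    _ = _ := by
        rw [Finset.sum_add_distrib, ← Finset.sum_mul, ← Finset.mul_sum, ← hs]
        simp; ring

lemma aux_lap_rad {n : ℕ} {f : EuclideanSpace ℝ (Fin n) → ℝ} (hf : ContDiff ℝ 2 f)
    (x : EuclideanSpace ℝ (Fin n)) (hx : 0 < ‖x‖) {P P1 P2 : ℝ → ℝ}
    (h1 : ∀ r > 0, HasDerivAt P (P1 r) r) (h2 : ∀ r > 0, HasDerivAt P1 (P2 r) r)
    (hle : ∀ᶠ y in nhds x, f y ≤ P ‖y‖) (heq : f x = P ‖x‖) :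
    lap n f x ≤ P2 ‖x‖ + ((n : ℝ) - 1) / ‖x‖ * P1 ‖x‖ := by
  have hs : ∀ u > (0:ℝ), HasDerivAt Real.sqrt (1 / (2 * √u)) u := fun u hu =>
    Real.hasDerivAt_sqrt hu.ne'
  have hsq : √(‖x‖ ^ 2) = ‖x‖ := Real.sqrt_sq hx.le
  have hx2 : 0 < ‖x‖ ^ 2 := by positivity
  have a1 : ∀ u > (0:ℝ), HasDerivAt (fun u => P (√u)) (P1 (√u) * (1 / (2 * √u))) u := fun u hu =>
    (h1 _ (Real.sqrt_pos.2 hu)).comp u (hs u hu)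
  have a2 : HasDerivAt (fun u => P1 (√u) * (1 / (2 * √u)))
      (P2 ‖x‖ * (1 / (2 * ‖x‖)) * (1 / (2 * ‖x‖)) + P1 ‖x‖ * (-(2 * (1 / (2 * ‖x‖))) / (2 * ‖x‖) ^ 2))
      (‖x‖ ^ 2) := by
    have b1 : HasDerivAt (fun u => P1 (√u)) (P2 ‖x‖ * (1 / (2 * ‖x‖))) (‖x‖ ^ 2) := by
      have := (h2 _ (Real.sqrt_pos.2 hx2)).comp _ (hs _ hx2)
      rw [hsq] at this; exact this
    have b2 : HasDerivAt (fun u => (2 * √u)⁻¹) (-(2 * (1 / (2 * ‖x‖))) / (2 * ‖x‖) ^ 2) (‖x‖ ^ 2) := by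
      have := ((hs _ hx2).const_mul 2).inv (by rw [hsq]; positivity)
      rw [hsq] at this; exact this
    have := b1.mul b2
    simp only [hsq] at this
    simp only [one_div] at this ⊢
    exact this
  have := aux_lap_sq hf x (F := fun u => P (√u)) (eventually_of_mem (Ioi_mem_nhds hx2) a1) a2
    (by filter_upwards [hle] with y hy; rwa [Real.sqrt_sq (norm_nonneg y)]) (by rw [hsq]; exact heq)
  refine this.trans (le_of_eq ?_)
  rw [hsq]
  field_simp
  ring

lemma aux_phi_zero {n : ℕ} (hn : 10 < n) {p α a : ℝ} (hp : 1 < p) {φ : ℝ → ℝ}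
    (hφ : IsSteadyStateA n p α φ a) {R : ℝ} (hR : 0 < R) {s : ℝ} (hs0 : 0 ≤ s) (hs : s ≤ R) :
    φ s ≤ φ 0 - φ R ^ p / (2 * n) * s ^ 2 := by
  have hn0 : (0:ℝ) < n := by positivity
  set q := φ R ^ p with hq
  have hqpos : 0 < q := rpow_pos_of_pos (hφ.pos R hR.le) p
  have hd1 : ∀ r > 0, HasDerivAt φ (deriv φ r) r := fun r hr =>
    ((hφ.smooth.differentiableOn (by norm_num)).differentiableAt (Ioi_mem_nhds hr)).hasDerivAt
  have hd2 : ∀ r > 0, HasDerivAt (deriv φ) (deriv (deriv φ) r) r := fun r hr =>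
    ((((contDiffOn_succ_iff_deriv_of_isOpen (n := 1) isOpen_Ioi).1
      (by have h := hφ.smooth; rw [← one_add_one_eq_two] at h; exact h)).2.2.differentiableOn (by norm_num)).differentiableAt
        (Ioi_mem_nhds hr)).hasDerivAt
  have hneg : ∀ r > 0, deriv φ r ≤ 0 := by
    intro r hr
    have := aux_left_deriv (hd1 r hr) (by
      filter_upwards [Ioo_mem_nhdsLT hr] with s hs
      exact (hφ.anti (mem_Ici.2 hs.1.le) (mem_Ici.2 hr.le) hs.2).le)
    exact this
  have hpow : ∀ k : ℕ, ∀ r : ℝ, HasDerivAt (fun r : ℝ => r ^ k) (k * r ^ (k - 1)) r :=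
    fun k r => hasDerivAt_pow k r
  have hanti : AntitoneOn (fun r => r ^ (n - 1) * deriv φ r + q / n * r ^ n) (Ioc 0 R) := by
    have hD : ∀ r > 0, HasDerivAt (fun r => r ^ (n - 1) * deriv φ r + q / n * r ^ n)
        (r ^ (n - 1) * (q - φ r ^ p)) r := by
      intro r hr
      have := ((hpow (n - 1) r).mul (hd2 r hr)).add ((hpow n r).const_mul (q / n))
      refine HasDerivAt.congr_deriv this ?_
      have ho := hφ.ode r hr
      have e : r ^ (n - 1) = r ^ (n - 1 - 1) * r := by
        rw [← pow_succ]; congr 1; omega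
      have ec : ((n - 1 : ℕ) : ℝ) = n - 1 := by
        rw [Nat.cast_sub (by omega)]; simp
      have ho' : deriv (deriv φ) r = -((n : ℝ) - 1) / r * deriv φ r - φ r ^ p := by
        rw [neg_div]; linarith
      rw [ec, ho', e]
      field_simp
      ring
    apply antitoneOn_of_deriv_nonpos (convex_Ioc 0 R)
    · intro r hr; exact (hD r hr.1).continuousAt.continuousWithinAt
    · intro r hr; rw [interior_Ioc] at hr; exact (hD r hr.1).differentiableAt.differentiableWithinAt
    · intro r hr
      rw [interior_Ioc] at hr
      rw [(hD r hr.1).deriv]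
      have h1 : q ≤ φ r ^ p := rpow_le_rpow (hφ.pos R hR.le).le
        (hφ.anti (mem_Ici.2 hr.1.le) (mem_Ici.2 hR.le) hr.2).le (by linarith)
      have : 0 ≤ r ^ (n - 1) := pow_nonneg hr.1.le _
      nlinarith
  have hderiv : ∀ r ∈ Ioo 0 R, deriv φ r + q / n * r ≤ 0 := by
    intro r hr
    have hlim : Tendsto (fun ρ : ℝ => q / n * ρ ^ n) (nhdsWithin 0 (Ioi 0)) (nhds 0) := by
      have : Tendsto (fun ρ : ℝ => q / n * ρ ^ n) (nhds 0) (nhds (q / n * 0 ^ n)) :=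
        (by fun_prop : Continuous fun ρ : ℝ => q / n * ρ ^ n).tendsto 0
      rw [zero_pow (by omega), mul_zero] at this
      exact this.mono_left nhdsWithin_le_nhds
    have h1 : r ^ (n - 1) * deriv φ r + q / n * r ^ n ≤ 0 := by
      refine ge_of_tendsto hlim ?_
      filter_upwards [Ioo_mem_nhdsGT hr.1] with ρ hρ
      have := hanti ⟨hρ.1, (hρ.2.trans hr.2).le⟩ ⟨hr.1, hr.2.le⟩ hρ.2.le
      simp only at this
      have h3 : ρ ^ (n - 1) * deriv φ ρ ≤ 0 :=
        mul_nonpos_of_nonneg_of_nonpos (pow_nonneg hρ.1.le _) (hneg ρ hρ.1)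
      linarith
    have e : r ^ n = r ^ (n - 1) * r := by rw [← pow_succ]; congr 1; omega
    have h2 : r ^ (n - 1) * (deriv φ r + q / n * r) ≤ 0 := by rw [e] at h1; linarith
    by_contra hc
    push Not at hc
    have := mul_pos (pow_pos hr.1 (n - 1)) hc
    linarith
  have hfin : AntitoneOn (fun r => φ r + q / (2 * n) * r ^ 2) (Icc 0 R) := by
    have hD : ∀ r > 0, HasDerivAt (fun r => φ r + q / (2 * n) * r ^ 2)
        (deriv φ r + q / n * r) r := by
      intro r hr
      have := (hd1 r hr).add ((hpow 2 r).const_mul (q / (2 * n)))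
      refine HasDerivAt.congr_deriv this ?_
      simp; field_simp
    apply antitoneOn_of_deriv_nonpos (convex_Icc 0 R)
    · exact (hφ.cont.mono Icc_subset_Ici_self).add (by fun_prop)
    · intro r hr; rw [interior_Icc] at hr; exact (hD r hr.1).differentiableAt.differentiableWithinAt
    · intro r hr
      rw [interior_Icc] at hr
      rw [(hD r hr.1).deriv]
      exact hderiv r hr
  have := hfin ⟨le_rfl, hR.le⟩ ⟨hs0, hs⟩ hs0
  simp at this
  linarith

lemma aux_phi_derivs {n : ℕ} {p α a : ℝ} {φ : ℝ → ℝ}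
    (hφ : IsSteadyStateA n p α φ a) :
    (∀ r > 0, HasDerivAt φ (deriv φ r) r) ∧
    (∀ r > 0, HasDerivAt (deriv φ) (deriv (deriv φ) r) r) := by
  refine ⟨fun r hr =>
    ((hφ.smooth.differentiableOn (by norm_num)).differentiableAt (Ioi_mem_nhds hr)).hasDerivAt,
    fun r hr =>
    ((((contDiffOn_succ_iff_deriv_of_isOpen (n := 1) isOpen_Ioi).1
      (by have h := hφ.smooth; rw [← one_add_one_eq_two] at h; exact h)).2.2.differentiableOn
        (by norm_num)).differentiableAt (Ioi_mem_nhds hr)).hasDerivAt⟩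

/-- the pointwise strict supersolution inequality -/
lemma aux_strict {n : ℕ} {p f V W E g H h Λ κ c0 D : ℝ} (hp : 1 < p) (hf : 0 < f) (hV : 0 < V)
    (hVe : V = f - E * g) (hWe : W = V + H * h) (hH : 0 < H) (hh : 0 < h) (hE : 0 < E)
    (hg : 0 ≤ g) (hκ : 0 ≤ κ) (hΛ : 2 * n < p * c0 * (Λ - 1)) (hΛ1 : 1 ≤ Λ)
    (hc : c0 ≤ V ^ (p - 1) * h) (hD : 0 ≤ D + (1 + κ) * p * V ^ (p - 1) * g) :
    -f ^ p - E * D + 2 * n * H + W ^ p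
      < p * W ^ (p - 1) * (κ * E * g + Λ * H * h) := by
  have hHh : 0 < H * h := mul_pos hH hh
  have hW : 0 < W := by rw [hWe]; positivity
  have hVW : V ≤ W := by linarith
  have h1 := aux_tangent hp hV hW
  have h2 := aux_tangent hp hf hV
  have h3 : V ^ (p - 1) ≤ W ^ (p - 1) := rpow_le_rpow hV.le hVW (by linarith)
  have e1 : V - W = -(H * h) := by linarith
  have e2 : f - V = E * g := by linarith
  rw [e1] at h1
  rw [e2] at h2
  set X := V ^ (p - 1)
  set Y := W ^ (p - 1)
  have h4 : p * X * (κ * E * g) ≤ p * Y * (κ * E * g) := by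
    have : 0 ≤ κ * E * g := by positivity
    gcongr
  have h5 : p * X * ((Λ - 1) * (H * h)) ≤ p * Y * ((Λ - 1) * (H * h)) := by
    have : 0 ≤ (Λ - 1) * (H * h) := mul_nonneg (by linarith) hHh.le
    gcongr
  have h6 : p * c0 * (Λ - 1) * H ≤ p * (X * h) * (Λ - 1) * H := by
    have : 0 ≤ Λ - 1 := by linarith
    gcongr
  have h7 := mul_lt_mul_of_pos_right hΛ hH
  have h8 := mul_nonneg hE.le hD
  nlinarith

lemma aux_compare {n : ℕ} (hn : 10 < n) {p α a κ c0 r1 : ℝ} (hp : 1 < p) {φ : ℝ → ℝ}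
    (hφ : IsSteadyStateA n p α φ a) (hκ : 0 ≤ κ) (hc0 : 0 < c0) (hr1 : 0 < r1)
    {G G1 G2 : ℝ → ℝ} (hG1 : ∀ r > 0, HasDerivAt G (G1 r) r)
    (hG2 : ∀ r > 0, HasDerivAt G1 (G2 r) r) (hGmax : ∀ r > 0, r ≤ r1 → G r ≤ G r1)
    (hGnn : ∀ r ≥ 0, 0 ≤ G (max r r1))
    (hpos : ∀ r ≥ 0, 0 < φ r - G (max r r1))
    (hc : ∀ r ≥ 0, c0 ≤ (φ r - G (max r r1)) ^ (p - 1) * (1 + r ^ 2))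
    (hsub : ∀ r ≥ r1, 0 ≤ G2 r + ((n : ℝ) - 1) / r * G1 r +
      (1 + κ) * p * (φ r - G r) ^ (p - 1) * G r)
    {v : EuclideanSpace ℝ (Fin n) → ℝ → ℝ} {v₀ : EuclideanSpace ℝ (Fin n) → ℝ}
    (hv : IsBddClassicalSol n p v v₀) (hv0 : ∀ x, v₀ x ≤ φ ‖x‖ - G (max ‖x‖ r1)) :
    ∀ x, ∀ t ≥ 0, v x t ≤ φ ‖x‖ - exp (-κ * t) * G (max ‖x‖ r1) := by
  have hn0 : (0:ℝ) < n := by positivity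
  obtain ⟨hd1, hd2⟩ := aux_phi_derivs hφ
  set Λ : ℝ := 2 * n / (p * c0) + 2 with hΛdef
  have hΛpos : 0 < 2 * n / (p * c0) := by positivity
  have hΛ : 2 * n < p * c0 * (Λ - 1) := by
    have : p * c0 * (2 * n / (p * c0)) = 2 * n := by field_simp
    have h2 : 0 < p * c0 := by positivity
    rw [hΛdef]
    nlinarith
  -- strict comparison
  suffices hη : ∀ η > 0, ∀ T > 0, ∀ x, ∀ t ∈ Icc 0 T,
      v x t < φ ‖x‖ - exp (-κ * t) * G (max ‖x‖ r1) + η * exp (Λ * t) * (1 + ‖x‖ ^ 2) by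
    intro x t ht
    have hlim : Tendsto (fun η : ℝ => φ ‖x‖ - exp (-κ * t) * G (max ‖x‖ r1)
        + η * exp (Λ * t) * (1 + ‖x‖ ^ 2)) (nhdsWithin 0 (Ioi 0))
        (nhds (φ ‖x‖ - exp (-κ * t) * G (max ‖x‖ r1))) := by
      have : Tendsto (fun η : ℝ => φ ‖x‖ - exp (-κ * t) * G (max ‖x‖ r1)
        + η * exp (Λ * t) * (1 + ‖x‖ ^ 2)) (nhds 0) (nhds (φ ‖x‖ - exp (-κ * t) * G (max ‖x‖ r1)
        + 0 * exp (Λ * t) * (1 + ‖x‖ ^ 2))) := by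
        apply Continuous.tendsto (f := fun η : ℝ => φ ‖x‖ - exp (-κ * t) * G (max ‖x‖ r1)
          + η * exp (Λ * t) * (1 + ‖x‖ ^ 2))
        fun_prop
      simp only [zero_mul, add_zero] at this
      exact this.mono_left nhdsWithin_le_nhds
    refine ge_of_tendsto hlim ?_
    filter_upwards [self_mem_nhdsWithin] with η hη'
    exact (hη η hη' (t + 1) (by linarith) x t ⟨ht, by linarith⟩).le
  intro η hη T hT
  set W : EuclideanSpace ℝ (Fin n) → ℝ → ℝ := fun x t =>
    φ ‖x‖ - exp (-κ * t) * G (max ‖x‖ r1) + η * exp (Λ * t) * (1 + ‖x‖ ^ 2) with hW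
  have hexp : ∀ t ≥ 0, exp (-κ * t) ≤ 1 := fun t ht => by
    rw [Real.exp_le_one_iff]; nlinarith
  have hVle : ∀ x : EuclideanSpace ℝ (Fin n), ∀ t ≥ 0,
      φ ‖x‖ - G (max ‖x‖ r1) ≤ φ ‖x‖ - exp (-κ * t) * G (max ‖x‖ r1) := by
    intro x t ht
    have := mul_le_mul_of_nonneg_right (hexp t ht) (hGnn ‖x‖ (norm_nonneg x))
    linarith
  have hφc : Continuous fun x : EuclideanSpace ℝ (Fin n) => φ ‖x‖ :=
    hφ.cont.comp_continuous continuous_norm fun x => norm_nonneg x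
  have hGc : Continuous fun x : EuclideanSpace ℝ (Fin n) => G (max ‖x‖ r1) := by
    have : ContinuousOn G (Ioi 0) := fun r hr => (hG1 r hr).continuousAt.continuousWithinAt
    exact this.comp_continuous (by fun_prop) fun x => lt_max_of_lt_right hr1
  have hWc : Continuous fun q : EuclideanSpace ℝ (Fin n) × ℝ => W q.1 q.2 := by
    have h1 := hφc.comp (continuous_fst (X := EuclideanSpace ℝ (Fin n)) (Y := ℝ))
    have h2 := hGc.comp (continuous_fst (X := EuclideanSpace ℝ (Fin n)) (Y := ℝ))
    simp only [Function.comp_def] at h1 h2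
    have h3 : Continuous fun q : EuclideanSpace ℝ (Fin n) × ℝ => exp (-κ * q.2) := by fun_prop
    have h4 : Continuous fun q : EuclideanSpace ℝ (Fin n) × ℝ =>
      η * exp (Λ * q.2) * (1 + ‖q.1‖ ^ 2) := by fun_prop
    exact (h1.sub (h3.mul h2)).add h4
  by_contra hcon
  push Not at hcon
  obtain ⟨xb, tb, htb, hb⟩ := hcon
  obtain ⟨M, hM⟩ := hv.bdd T hT
  obtain ⟨R, hR⟩ : ∃ R : ℝ, ∀ x, ∀ t ∈ Icc 0 T, W x t ≤ v x t → ‖x‖ ≤ R := by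
    refine ⟨M / η + 1, fun x t ht h => ?_⟩
    have h1 := hM x t ht
    have h2 := hpos ‖x‖ (norm_nonneg x)
    have h3 := hVle x t ht.1
    have h4 : η * (1 + ‖x‖ ^ 2) ≤ η * exp (Λ * t) * (1 + ‖x‖ ^ 2) := by
      have : 1 ≤ exp (Λ * t) := Real.one_le_exp (mul_nonneg (by linarith) ht.1)
      have h5 : 0 ≤ η * (1 + ‖x‖ ^ 2) := by positivity
      nlinarith
    have h5 : η * (1 + ‖x‖ ^ 2) ≤ M := by simp only [hW] at h; linarith
    have h6 : 1 + ‖x‖ ^ 2 ≤ M / η := by rw [le_div_iff₀ hη]; linarith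
    nlinarith [sq_nonneg (‖x‖ - 1)]
  set S : Set (EuclideanSpace ℝ (Fin n) × ℝ) :=
    (Metric.closedBall 0 R ×ˢ Icc 0 T) ∩ {q | 0 ≤ v q.1 q.2 - W q.1 q.2} with hS
  have hcomp : IsCompact (Metric.closedBall (0 : EuclideanSpace ℝ (Fin n)) R ×ˢ Icc (0:ℝ) T) :=
    (isCompact_closedBall 0 R).prod isCompact_Icc
  have hScomp : IsCompact S := by
    have hcl : IsClosed S := by
      refine ContinuousOn.preimage_isClosed_of_isClosed
        (f := fun q : EuclideanSpace ℝ (Fin n) × ℝ => v q.1 q.2 - W q.1 q.2)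
        (t := Ici 0) ?_ hcomp.isClosed isClosed_Ici
      refine (hv.cont.mono ?_).sub hWc.continuousOn
      rintro ⟨x, t⟩ ⟨-, ht⟩
      exact ⟨mem_univ _, ht.1⟩
    exact hcomp.of_isClosed_subset hcl inter_subset_left
  have hmem : ∀ x, ∀ t ∈ Icc 0 T, W x t ≤ v x t → (x, t) ∈ S := by
    intro x t ht h
    refine ⟨⟨?_, ht⟩, ?_⟩
    · simpa using hR x t ht h
    · simp only [mem_ofPred_eq]; linarith
  obtain ⟨⟨x0, t0⟩, hq, hqmin⟩ := hScomp.exists_isMinOn ⟨(xb, tb), hmem xb tb htb hb⟩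
    (continuous_snd.continuousOn)
  have ht0 : t0 ∈ Icc 0 T := hq.1.2
  have hge : W x0 t0 ≤ v x0 t0 := by have := hq.2; simp only [mem_ofPred_eq] at this; linarith
  have hlt : ∀ x, ∀ t ∈ Ico 0 t0, v x t < W x t := by
    intro x t ht
    by_contra hcc
    push Not at hcc
    have := hqmin (hmem x t ⟨ht.1, ht.2.le.trans ht0.2⟩ hcc)
    simp only [mem_ofPred_eq] at this
    linarith [ht.2]
  have ht0pos : 0 < t0 := by
    rcases ht0.1.lt_or_eq with h | h
    · exact h
    · exfalso
      rw [← h] at hge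
      rw [hv.init] at hge
      have h1 := hv0 x0
      simp only [hW] at hge
      simp only [mul_zero, Real.exp_zero, one_mul, mul_one] at hge
      have : 0 < η * (1 + ‖x0‖ ^ 2) := by positivity
      linarith
  have hle : ∀ x, v x t0 ≤ W x t0 := by
    intro x
    have c1 : ContinuousOn (fun s => W x s - v x s) (Ici 0) := by
      refine ContinuousOn.sub ?_ ?_
      · exact (hWc.comp (by fun_prop : Continuous fun s : ℝ => (x, s))).continuousOn
      · exact hv.cont.comp (by fun_prop : ContinuousOn (fun s : ℝ => (x, s)) (Ici 0))
          fun s hs => ⟨mem_univ _, hs⟩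
    have c2 : Tendsto (fun s => W x s - v x s) (nhdsWithin t0 (Iio t0)) (nhds (W x t0 - v x t0)) :=
      (c1.continuousAt (Ici_mem_nhds ht0pos)).tendsto.mono_left nhdsWithin_le_nhds
    have := ge_of_tendsto c2 (b := 0) (by
      filter_upwards [Ioo_mem_nhdsLT ht0pos] with s hs
      have := hlt x s ⟨hs.1.le, hs.2⟩
      linarith)
    linarith
  have heq : v x0 t0 = W x0 t0 := le_antisymm (hle x0) hge
  -- data at the touching point
  set r := ‖x0‖ with hr
  have hr0 : 0 ≤ r := norm_nonneg x0
  set E := exp (-κ * t0) with hE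
  set H := η * exp (Λ * t0) with hH
  have hEpos : 0 < E := Real.exp_pos _
  have hHpos : 0 < H := by positivity
  have hVpos : 0 < φ r - E * G (max r r1) := lt_of_lt_of_le (hpos r hr0) (hVle x0 t0 ht0.1)
  have hW0 : W x0 t0 = φ r - E * G (max r r1) + H * (1 + r ^ 2) := rfl
  have hWpos : 0 < W x0 t0 := by rw [hW0]; positivity
  have hcV : c0 ≤ (φ r - E * G (max r r1)) ^ (p - 1) * (1 + r ^ 2) := by
    refine (hc r hr0).trans ?_
    have := rpow_le_rpow (hpos r hr0).le (hVle x0 t0 ht0.1) (by linarith : 0 ≤ p - 1)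
    gcongr
  -- time derivative
  have htime : p * W x0 t0 ^ (p - 1) * (κ * E * G (max r r1) + Λ * H * (1 + r ^ 2))
      ≤ lap n (fun y => v y t0) x0 + W x0 t0 ^ p := by
    have d1 : HasDerivAt (fun s => W x0 s) (κ * E * G (max r r1) + Λ * H * (1 + r ^ 2)) t0 := by
      have e1 : HasDerivAt (fun s => exp (-κ * s)) (exp (-κ * t0) * (-κ * 1)) t0 :=
        ((hasDerivAt_id t0).const_mul (-κ)).exp
      have e2 : HasDerivAt (fun s => exp (Λ * s)) (exp (Λ * t0) * (Λ * 1)) t0 :=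
        ((hasDerivAt_id t0).const_mul Λ).exp
      refine HasDerivAt.congr_deriv (((e1.mul_const (G (max r r1))).const_sub (φ r)).add
        ((e2.const_mul η).mul_const (1 + r ^ 2))) ?_
      rw [hE, hH]; ring
    have d2 : HasDerivAt (fun s => W x0 s ^ p)
        ((κ * E * G (max r r1) + Λ * H * (1 + r ^ 2)) * p * W x0 t0 ^ (p - 1)) t0 :=
      d1.rpow_const (Or.inl hWpos.ne')
    have d3 : HasDerivAt (fun s => v x0 s ^ p) (deriv (fun s => v x0 s ^ p) t0) t0 :=
      (((hv.smooth_time x0).differentiableOn (by norm_num)).differentiableAt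
        (Ioi_mem_nhds ht0pos)).hasDerivAt
    have := aux_left_deriv (d2.sub d3) (by
      filter_upwards [Ioo_mem_nhdsLT ht0pos] with s hs
      have h1 := rpow_le_rpow (hv.nonneg x0 s hs.1.le) (hlt x0 s ⟨hs.1.le, hs.2⟩).le
        (by linarith : 0 ≤ p)
      simp only [Pi.sub_apply]
      rw [heq]
      linarith)
    rw [hv.pde x0 t0 ht0pos, heq] at this
    linarith
  have hsm := hv.smooth_space t0 ht0pos
  rcases hr0.lt_or_eq with hrpos | hrz
  · rcases lt_or_ge r r1 with hrr | hrr
    · -- inner region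
      have hm : max r r1 = r1 := max_eq_right hrr.le
      rw [hm] at hVpos hW0 hcV htime
      have hlap := aux_lap_rad hsm x0 hrpos
        (P := fun s => φ s - E * G r1 + H * (1 + s ^ 2))
        (P1 := fun s => deriv φ s + H * (2 * s)) (P2 := fun s => deriv (deriv φ) s + H * 2)
        (by
          intro s hs
          refine HasDerivAt.congr_deriv (((hd1 s hs).sub_const (E * G r1)).add
            ((((hasDerivAt_id s).pow 2).const_add 1).const_mul H)) ?_
          simp)
        (by
          intro s hs
          refine HasDerivAt.congr_deriv ((hd2 s hs).add
            (((hasDerivAt_id s).const_mul 2).const_mul H)) ?_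
          simp)
        (by
          have : ∀ᶠ y in nhds x0, ‖y‖ < r1 :=
            continuous_norm.continuousAt.eventually_lt continuousAt_const hrr
          filter_upwards [this] with y hy
          have h := hle y
          simp only [hW, max_eq_right hy.le] at h
          exact h)
        (by rw [heq, hW0])
      have ho := hφ.ode r hrpos
      have hg0 : 0 ≤ G r1 := by have := hGnn r hr0; rwa [hm] at this
      have := aux_strict (n := n) (D := 0) hp (hφ.pos r hr0) hVpos rfl hW0 hHpos
        (by positivity) hEpos hg0 hκ hΛ (by linarith) hcV (by
          have := rpow_nonneg hVpos.le (p - 1)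
          have : 0 ≤ 1 + κ := by linarith
          have : 0 ≤ p := by linarith
          positivity)
      have e : deriv (deriv φ) r + H * 2 + ((n : ℝ) - 1) / r * (deriv φ r + H * (2 * r))
          = - φ r ^ p + 2 * n * H := by
        have : ((n : ℝ) - 1) / r * (H * (2 * r)) = (n - 1) * (2 * H) := by field_simp
        rw [mul_add, this]; linarith
      rw [← hr] at hlap
      simp only [e] at hlap
      linarith
    · -- outer region
      have hm : max r r1 = r := max_eq_left hrr
      rw [hm] at hVpos hW0 hcV htime
      have hlap := aux_lap_rad hsm x0 hrpos
        (P := fun s => φ s - E * G s + H * (1 + s ^ 2))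
        (P1 := fun s => deriv φ s - E * G1 s + H * (2 * s))
        (P2 := fun s => deriv (deriv φ) s - E * G2 s + H * 2)
        (by
          intro s hs
          refine HasDerivAt.congr_deriv (((hd1 s hs).sub ((hG1 s hs).const_mul E)).add
            ((((hasDerivAt_id s).pow 2).const_add 1).const_mul H)) ?_
          simp)
        (by
          intro s hs
          refine HasDerivAt.congr_deriv (((hd2 s hs).sub ((hG2 s hs).const_mul E)).add
            (((hasDerivAt_id s).const_mul 2).const_mul H)) ?_
          simp)
        (by
          have : ∀ᶠ y in nhds x0, 0 < ‖y‖ :=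
            continuousAt_const.eventually_lt continuous_norm.continuousAt hrpos
          filter_upwards [this] with y hy
          have h := hle y
          have h2 : G ‖y‖ ≤ G (max ‖y‖ r1) := by
            rcases le_total ‖y‖ r1 with h3 | h3
            · rw [max_eq_right h3]; exact hGmax _ hy h3
            · rw [max_eq_left h3]
          have h4 := mul_le_mul_of_nonneg_left h2 hEpos.le
          simp only [hW] at h
          linarith)
        (by rw [heq, hW0])
      have ho := hφ.ode r hrpos
      have hg0 : 0 ≤ G r := by have := hGnn r hr0; rwa [hm] at this
      have := aux_strict (n := n) (D := G2 r + ((n : ℝ) - 1) / r * G1 r) hp (hφ.pos r hr0)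
        hVpos rfl hW0 hHpos (by positivity) hEpos hg0 hκ hΛ (by linarith) hcV (by
          refine (hsub r hrr).trans ?_
          have h9 := hpos r hr0
          have h10 := hVle x0 t0 ht0.1
          rw [← hr] at h10
          rw [hm] at h9 h10
          have := rpow_le_rpow h9.le h10 (by linarith : 0 ≤ p - 1)
          have : 0 ≤ 1 + κ := by linarith
          have : 0 ≤ p := by linarith
          gcongr)
      have e : deriv (deriv φ) r - E * G2 r + H * 2
          + ((n : ℝ) - 1) / r * (deriv φ r - E * G1 r + H * (2 * r))
          = - φ r ^ p - E * (G2 r + ((n : ℝ) - 1) / r * G1 r) + 2 * n * H := by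
        have : ((n : ℝ) - 1) / r * (H * (2 * r)) = (n - 1) * (2 * H) := by field_simp
        rw [mul_add, this]; linarith
      rw [← hr] at hlap
      simp only [e] at hlap
      linarith
  · -- the origin
    have hm : max r r1 = r1 := max_eq_right (by rw [← hrz]; exact hr1.le)
    rw [hm] at hVpos hW0 hcV htime
    have hg0 : 0 ≤ G r1 := by have := hGnn r hr0; rwa [hm] at this
    have hstr := aux_strict (n := n) (D := 0) hp (hφ.pos r hr0) hVpos rfl hW0 hHpos
        (by positivity) hEpos hg0 hκ hΛ (by linarith) hcV (by
          have := rpow_nonneg hVpos.le (p - 1)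
          have : 0 ≤ 1 + κ := by linarith
          have : 0 ≤ p := by linarith
          positivity)
    have hfin : ∀ ρ > 0, ρ < r1 → lap n (fun y => v y t0) x0 ≤ - φ ρ ^ p + 2 * n * H := by
      intro ρ hρ hρ1
      have hlap := aux_lap_sq hsm x0
        (F := fun s => φ 0 - E * G r1 + H + (H - φ ρ ^ p / (2 * n)) * s)
        (F1 := fun s => H - φ ρ ^ p / (2 * n)) (F2 := 0)
        (Eventually.of_forall fun s => by
          refine HasDerivAt.congr_deriv (((hasDerivAt_id s).const_mul
            (H - φ ρ ^ p / (2 * n))).const_add (φ 0 - E * G r1 + H)) ?_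
          simp)
        (hasDerivAt_const _ _)
        (by
          have : ∀ᶠ y in nhds x0, ‖y‖ < ρ :=
            continuous_norm.continuousAt.eventually_lt continuousAt_const
              (by rw [← hr, ← hrz]; exact hρ)
          filter_upwards [this] with y hy
          have h := hle y
          have h2 := aux_phi_zero hn hp hφ hρ (norm_nonneg y) hy.le
          simp only [hW, max_eq_right (hy.trans hρ1).le] at h
          linarith)
        (by rw [heq, hW0, ← hr, ← hrz]; ring)
      refine hlap.trans (le_of_eq ?_)
      field_simp
      ring
    have hlim : Tendsto (fun ρ => - φ ρ ^ p + 2 * n * H) (nhdsWithin 0 (Ioi 0))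
        (nhds (- φ 0 ^ p + 2 * n * H)) := by
      have c1 : Tendsto φ (nhdsWithin 0 (Ioi 0)) (nhds (φ 0)) :=
        (hφ.cont 0 (mem_Ici.2 le_rfl)).mono_left (nhdsWithin_mono _ Ioi_subset_Ici_self)
      exact ((c1.rpow_const (Or.inl (hφ.pos 0 le_rfl).ne')).neg).add_const _
    have := ge_of_tendsto hlim (by
      filter_upwards [Ioo_mem_nhdsGT hr1] with ρ hρ using hfin ρ hρ.1 hρ.2)
    rw [hrz] at this
    linarith

lemma aux_params {n : ℕ} (hn : 10 < n) {p γ : ℝ} (hp : pc n < p)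
    (hγ : γ ∈ Set.Ioo (nuExp p + lam1 n p) (((n : ℝ) - 2) / 2)) :
    1 < p ∧ 0 < nuExp p ∧ 0 < lam1 n p ∧ 0 < Lconst n p ∧ 0 ≤ kappaOf n p γ ∧
    (1 + kappaOf n p γ) * p * Lconst n p ^ (p - 1) = γ * ((n : ℝ) - 2 - γ) := by
  have hn' : (11:ℝ) ≤ n := by exact_mod_cast hn
  have hs : 0 ≤ √((n:ℝ) - 1) := Real.sqrt_nonneg _
  have hden : 0 < ((n : ℝ) - 2) * ((n : ℝ) - 10) := mul_pos (by linarith) (by linarith)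
  unfold pc at hp
  rw [div_lt_iff₀ hden] at hp
  have hp1 : 1 < p := by
    by_contra h
    push Not at h
    nlinarith
  have hq : 0 < p - 1 := by linarith
  set ν := nuExp p with hν
  have hνp : ν * (p - 1) = 2 := by rw [hν, nuExp]; field_simp
  have hνpos : 0 < ν := by rw [hν, nuExp]; positivity
  have h2ν : 2 * ν < (n : ℝ) - 2 := by
    -- (p-1)(n-2)(n-10) > 4n-16
    have h1 : 4 * (n : ℝ) - 16 < (p - 1) * (((n : ℝ) - 2) * ((n : ℝ) - 10)) := by nlinarith
    have h2 : ν * (4 * (n : ℝ) - 16) < 2 * (((n : ℝ) - 2) * ((n : ℝ) - 10)) := by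
      have := mul_lt_mul_of_pos_left h1 hνpos
      rw [← mul_assoc, hνp] at this
      exact this
    by_contra h
    push Not at h
    have h3 : ((n : ℝ) - 2) * (4 * (n : ℝ) - 16) ≤ 2 * ν * (4 * (n : ℝ) - 16) :=
      mul_le_mul_of_nonneg_right h (by linarith)
    nlinarith
  set m : ℝ := (n : ℝ) - 2 with hm
  have hbase : 0 < ν * (m - ν) := mul_pos hνpos (by linarith)
  have hL : 0 < Lconst n p := by
    rw [Lconst, ← hν, ← hm]; exact rpow_pos_of_pos hbase _
  have hLp : Lconst n p ^ (p - 1) = ν * (m - ν) := by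
    rw [Lconst, ← hν, ← hm, ← rpow_mul hbase.le, one_div, inv_mul_cancel₀ hq.ne', rpow_one]
  have hpL : p * Lconst n p ^ (p - 1) = (ν + 2) * (m - ν) := by
    rw [hLp, ← mul_assoc]; congr 1; linarith
  have hpLpos : 0 < p * Lconst n p ^ (p - 1) := by
    rw [hpL]; exact mul_pos (by linarith) (by linarith)
  set D : ℝ := (m - 2 * ν) ^ 2 - 8 * (m - ν) with hD
  have hlam : lam1 n p = ((m - 2 * ν) - √D) / 2 := rfl
  obtain ⟨hγ1, hγ2⟩ := hγ
  have hsD : 0 < √D := by rw [hlam] at hγ1; linarith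
  have hDpos : 0 < D := Real.sqrt_pos.1 hsD
  have hsq : √D ^ 2 = D := Real.sq_sqrt hDpos.le
  have hlampos : 0 < lam1 n p := by
    rw [hlam]
    have : √D < m - 2 * ν := by
      rw [Real.sqrt_lt' (by linarith)]; rw [hD]; nlinarith
    linarith
  refine ⟨hp1, hνpos, hlampos, hL, ?_, ?_⟩
  · have hroot : (ν + lam1 n p) * (m - (ν + lam1 n p)) = (ν + 2) * (m - ν) := by
      rw [hlam]; rw [hD] at hsq ⊢; nlinarith
    rw [kappaOf, ← hm, sub_nonneg, le_div_iff₀ hpLpos, one_mul, hpL, ← hroot]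
    nlinarith
  · rw [mul_assoc, kappaOf, ← hm]
    field_simp
    ring

set_option maxHeartbeats 4000000 in
lemma aux_barrier {n : ℕ} {p ν l L a b γ κ : ℝ} {φ : ℝ → ℝ} (hp : 1 < p) (hν : 0 < ν)
    (hνp : ν * (p - 1) = 2) (hl : 0 < l) (hL : 0 < L) (hκ : 0 ≤ κ)
    (hκe : (1 + κ) * p * L ^ (p - 1) = γ * ((n : ℝ) - 2 - γ)) (hb : 0 < b) (ha : 0 < a)
    (hγ1 : ν + l < γ) (hγ2 : γ < ((n : ℝ) - 2) / 2)
    (hpos : ∀ r ≥ (0 : ℝ), 0 < φ r) (hanti : StrictAntiOn φ (Set.Ici 0))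
    (hexpn : (fun r => φ r - (L * r ^ (-ν) - a * r ^ (-ν - l))) =o[atTop] fun r => r ^ (-ν - l)) :
    ∃ (c0 r1 : ℝ) (G G1 G2 : ℝ → ℝ), 0 < c0 ∧ 0 < r1 ∧ (∀ r > 0, HasDerivAt G (G1 r) r) ∧
    (∀ r > 0, HasDerivAt G1 (G2 r) r) ∧ (∀ r > 0, r ≤ r1 → G r ≤ G r1) ∧
    (∀ r ≥ 0, 0 < G (max r r1)) ∧ (∀ r ≥ 0, 0 < φ r - G (max r r1)) ∧
    (∀ r ≥ 0, c0 ≤ (φ r - G (max r r1)) ^ (p - 1) * (1 + r ^ 2)) ∧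
    (∀ r ≥ r1, 0 ≤ G2 r + ((n : ℝ) - 1) / r * G1 r +
      (1 + κ) * p * (φ r - G r) ^ (p - 1) * G r) ∧
    (∀ r ≥ 0, G (max r r1) ≤ b * (r + 1) ^ (-γ)) := by
  have hγ0 : 0 < γ := by linarith
  set m : ℝ := (n : ℝ) - 2 with hm
  set δ : ℝ := min l (m / 2 - γ) with hδ
  have hδ0 : 0 < δ := lt_min hl (by linarith)
  have hδl : δ ≤ l := min_le_left _ _
  have hδm : γ + δ ≤ m / 2 := by have : δ ≤ m / 2 - γ := min_le_right _ _; linarith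
  set K := γ * (m - γ) with hK
  set Kd := (γ + δ) * (m - (γ + δ)) with hKd
  have hK0 : 0 < K := mul_pos hγ0 (by linarith)
  have hKK : 0 < Kd - K := by
    have : Kd - K = δ * (m - 2 * γ - δ) := by rw [hK, hKd]; ring
    rw [this]; exact mul_pos hδ0 (by linarith)
  set B := (a + 2) / L with hB
  have hB0 : 0 < B := by positivity
  obtain ⟨N, hN⟩ := exists_nat_ge (max 1 (p - 1))
  have hN1 : (1:ℝ) ≤ N := (le_max_left _ _).trans hN
  have hNp : p - 1 ≤ N := (le_max_right _ _).trans hN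
  have hlow : ∀ᶠ r in atTop, L * r ^ (-ν) * (1 - B * r ^ (-δ)) ≤ φ r - r ^ (-γ) := by
    filter_upwards [hexpn.def (c := 1) one_pos, eventually_ge_atTop (1:ℝ)] with r hr hr1
    have hr0 : 0 < r := by linarith
    rw [Real.norm_eq_abs, Real.norm_eq_abs, abs_of_pos (rpow_pos_of_pos hr0 _), one_mul] at hr
    have h1 := (abs_le.1 hr).1
    have h2 : r ^ (-γ) ≤ r ^ (-ν - l) := rpow_le_rpow_of_exponent_le hr1 (by linarith)
    have h3 : r ^ (-ν - l) ≤ r ^ (-ν) * r ^ (-δ) := by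
      rw [← rpow_add hr0]; exact rpow_le_rpow_of_exponent_le hr1 (by linarith)
    have h4 : L * r ^ (-ν) * (1 - B * r ^ (-δ)) = L * r ^ (-ν) - (a + 2) * (r ^ (-ν) * r ^ (-δ)) := by
      rw [hB]; field_simp
    rw [h4]
    linarith [mul_le_mul_of_nonneg_left h3 (by linarith : (0:ℝ) ≤ a + 2)]
  have htend : Tendsto (fun r : ℝ => r ^ δ) atTop atTop := tendsto_rpow_atTop hδ0
  obtain ⟨R0, hR0⟩ := eventually_atTop.1 hlow
  obtain ⟨r1, hr1a, hr1b, hr1c, hr1d⟩ := ((eventually_ge_atTop R0).and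
    ((eventually_ge_atTop 1).and ((htend.eventually_ge_atTop (2 * B)).and
      (htend.eventually_ge_atTop (K * N * B / (Kd - K) * ((γ + δ) / γ)))))).exists
  have hr1 : 0 < r1 := by linarith
  set θ := γ / (γ + δ) with hθ
  have hθ0 : 0 < θ := by positivity
  have hθ1 : θ < 1 := by rw [hθ, div_lt_one (by linarith)]; linarith
  set A := r1 ^ δ * θ with hA
  have hA0 : 0 < A := by positivity
  have hAK : K * N * B ≤ A * (Kd - K) := by
    have h1 := mul_le_mul_of_nonneg_right hr1d hθ0.le
    have h2 : K * N * B / (Kd - K) * ((γ + δ) / γ) * θ = K * N * B / (Kd - K) := by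
      rw [hθ]; field_simp
    rw [h2, div_le_iff₀ hKK] at h1
    exact h1
  have hAg : A * (γ + δ) = γ * r1 ^ δ := by rw [hA, hθ]; field_simp
  have hydef : ∀ r ≥ r1, 0 < r ^ (-δ) ∧ r1 ^ δ * r ^ (-δ) ≤ 1 := by
    intro r hr
    have hr0 : 0 < r := by linarith
    refine ⟨rpow_pos_of_pos hr0 _, ?_⟩
    rw [rpow_neg hr0.le, ← div_eq_mul_inv, div_le_one (rpow_pos_of_pos hr0 _)]
    exact rpow_le_rpow hr1.le hr hδ0.le
  have hBy : ∀ r ≥ r1, B * r ^ (-δ) ≤ 1 / 2 := by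
    intro r hr
    obtain ⟨h1, h2⟩ := hydef r hr
    linarith [mul_le_mul_of_nonneg_right hr1c h1.le]
  have hAy : ∀ r ≥ r1, A * r ^ (-δ) ≤ θ := by
    intro r hr
    obtain ⟨h1, h2⟩ := hydef r hr
    rw [hA]; linarith [mul_le_mul_of_nonneg_left h2 hθ0.le]
  set ε := min 1 (min (b * 2 ^ (-γ)) (φ r1 / 2)) with hε
  have hφr1 : 0 < φ r1 := hpos r1 hr1.le
  have hε0 : 0 < ε := lt_min one_pos (lt_min (by positivity) (by positivity))
  have hε1 : ε ≤ 1 := min_le_left _ _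
  have hεb : ε ≤ b * 2 ^ (-γ) := (min_le_right _ _).trans (min_le_left _ _)
  have hεφ : ε ≤ φ r1 / 2 := (min_le_right _ _).trans (min_le_right _ _)
  set G : ℝ → ℝ := fun r => ε * (r ^ (-γ) - A * r ^ (-γ - δ)) with hG
  have hGe : ∀ r > 0, G r = ε * (r ^ (-γ) * (1 - A * r ^ (-δ))) := by
    intro r hr
    simp only [hG]
    rw [show -γ - δ = -γ + -δ by ring, rpow_add hr]; ring
  have hGpos : ∀ r ≥ r1, 0 < G r := by
    intro r hr
    have hr0 : 0 < r := by linarith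
    rw [hGe r hr0]
    have := hAy r hr
    exact mul_pos hε0 (mul_pos (rpow_pos_of_pos hr0 _) (by linarith))
  have hGle : ∀ r ≥ r1, G r ≤ ε * r ^ (-γ) := by
    intro r hr
    have hr0 : 0 < r := by linarith
    have h1 := rpow_pos_of_pos hr0 (-γ)
    have h2 : 0 < A * r ^ (-δ) := mul_pos hA0 (hydef r hr).1
    rw [hGe r hr0]
    apply mul_le_mul_of_nonneg_left _ hε0.le
    linarith [mul_pos h1 h2]
  set G1 : ℝ → ℝ := fun r => ε * (-γ * r ^ (-γ - 1) - A * ((-γ - δ) * r ^ (-γ - δ - 1))) with hG1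
  set G2 : ℝ → ℝ := fun r => ε * (-γ * ((-γ - 1) * r ^ (-γ - 1 - 1))
    - A * ((-γ - δ) * ((-γ - δ - 1) * r ^ (-γ - δ - 1 - 1)))) with hG2
  have hd : ∀ q : ℝ, ∀ r > 0, HasDerivAt (fun r : ℝ => r ^ q) (q * r ^ (q - 1)) r := fun q r hr =>
    Real.hasDerivAt_rpow_const (Or.inl hr.ne')
  have hdG : ∀ r > 0, HasDerivAt G (G1 r) r := fun r hr =>
    ((hd _ r hr).sub ((hd _ r hr).const_mul A)).const_mul ε
  have hdG1 : ∀ r > 0, HasDerivAt G1 (G2 r) r := fun r hr =>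
    (((hd _ r hr).const_mul (-γ)).sub (((hd _ r hr).const_mul (-γ - δ)).const_mul A)).const_mul ε
  have hVlow : ∀ r ≥ r1, L * r ^ (-ν) * (1 - B * r ^ (-δ)) ≤ φ r - G r := by
    intro r hr
    have h1 := hR0 r (hr1a.trans hr)
    have h2 := hGle r hr
    have h3 := rpow_pos_of_pos (by linarith : 0 < r) (-γ)
    linarith [mul_le_mul_of_nonneg_right hε1 h3.le]
  have hG1le : G r1 ≤ φ r1 / 2 := by
    have h1 := hGle r1 le_rfl
    have h2 : r1 ^ (-γ) ≤ 1 := rpow_le_one_of_one_le_of_nonpos hr1b (by linarith)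
    linarith [mul_le_mul_of_nonneg_left h2 hε0.le]
  have hpw : ∀ r > (0:ℝ), (r ^ (-ν)) ^ (p - 1) = (r ^ 2)⁻¹ := by
    intro r hr
    rw [← rpow_mul hr.le, neg_mul, hνp, rpow_neg hr.le]
    norm_num
  refine ⟨min ((φ r1 / 2) ^ (p - 1)) ((L / 2) ^ (p - 1)), r1, G, G1, G2, ?_, hr1, hdG, hdG1,
    ?_, ?_, ?_, ?_, ?_, ?_⟩
  · exact lt_min (by positivity) (by positivity)
  · have hmono : MonotoneOn G (Ioc 0 r1) := by
      apply monotoneOn_of_deriv_nonneg (convex_Ioc 0 r1)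
      · intro r hr; exact (hdG r hr.1).continuousAt.continuousWithinAt
      · intro r hr; rw [interior_Ioc] at hr
        exact (hdG r hr.1).differentiableAt.differentiableWithinAt
      · intro r hr
        rw [interior_Ioc] at hr
        rw [(hdG r hr.1).deriv]
        simp only [hG1]
        apply mul_nonneg hε0.le
        have e : r ^ (-γ - δ - 1) = r ^ (-γ - 1) * r ^ (-δ) := by
          rw [← rpow_add hr.1]; congr 1; ring
        have h1 : 1 ≤ r1 ^ δ * r ^ (-δ) := by
          rw [rpow_neg hr.1.le, ← div_eq_mul_inv, one_le_div (rpow_pos_of_pos hr.1 _)]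
          exact rpow_le_rpow hr.1.le hr.2.le hδ0.le
        have h2 := rpow_pos_of_pos hr.1 (-γ - 1)
        have e2 : -γ * r ^ (-γ - 1) - A * ((-γ - δ) * r ^ (-γ - δ - 1))
            = γ * r ^ (-γ - 1) * (r1 ^ δ * r ^ (-δ) - 1) := by
          rw [e]
          linear_combination (r ^ (-γ - 1) * r ^ (-δ)) * hAg
        rw [e2]
        exact mul_nonneg (by positivity) (by linarith)
    intro r hr hrr
    exact hmono ⟨hr, hrr⟩ ⟨hr1, le_rfl⟩ hrr
  · intro r _; exact hGpos _ (le_max_right _ _)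
  · intro r hr
    rcases le_total r r1 with h | h
    · rw [max_eq_right h]
      have := hanti.antitoneOn (mem_Ici.2 hr) (mem_Ici.2 hr1.le) h
      linarith
    · rw [max_eq_left h]
      have hr0 : 0 < r := by linarith
      refine lt_of_lt_of_le ?_ (hVlow r h)
      have := hBy r h
      exact mul_pos (mul_pos hL (rpow_pos_of_pos hr0 _)) (by linarith)
  · intro r hr
    rcases le_total r r1 with h | h
    · rw [max_eq_right h]
      have h0 := hanti.antitoneOn (mem_Ici.2 hr) (mem_Ici.2 hr1.le) h
      refine (min_le_left _ _).trans ?_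
      have h1 : (φ r1 / 2) ^ (p - 1) ≤ (φ r - G r1) ^ (p - 1) :=
        rpow_le_rpow (by positivity) (by linarith) (by linarith)
      have h2 : 0 < (φ r1 / 2) ^ (p - 1) := by positivity
      linarith [mul_nonneg (h2.le.trans h1) (sq_nonneg r)]
    · rw [max_eq_left h]
      have hr0 : 0 < r := by linarith
      refine (min_le_right _ _).trans ?_
      have h0 : L / 2 * r ^ (-ν) ≤ φ r - G r := by
        refine le_trans ?_ (hVlow r h)
        have h1 := hBy r h
        have h2 := mul_pos hL (rpow_pos_of_pos hr0 (-ν))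
        linarith [mul_le_mul_of_nonneg_left h1 h2.le]
      have h1 : (L / 2 * r ^ (-ν)) ^ (p - 1) ≤ (φ r - G r) ^ (p - 1) :=
        rpow_le_rpow (by positivity) h0 (by linarith)
      rw [mul_rpow (by positivity) (by positivity), hpw r hr0] at h1
      have h2 : 0 < (L / 2) ^ (p - 1) := by positivity
      calc (L / 2) ^ (p - 1) = (L / 2) ^ (p - 1) * (r ^ 2)⁻¹ * r ^ 2 := by field_simp
        _ ≤ (L / 2) ^ (p - 1) * (r ^ 2)⁻¹ * (1 + r ^ 2) := by gcongr; linarith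
        _ ≤ _ := by gcongr
  · intro r hr
    have hr0 : 0 < r := by linarith
    have hy := (hydef r hr).1
    have hByr := hBy r hr
    have hAyr := hAy r hr
    set y := r ^ (-δ) with hyd
    have hX := rpow_pos_of_pos hr0 (-γ)
    have hV : L ^ (p - 1) * (r ^ 2)⁻¹ * (1 - N * (B * y)) ≤ (φ r - G r) ^ (p - 1) := by
      have h1 : (L * r ^ (-ν) * (1 - B * y)) ^ (p - 1) ≤ (φ r - G r) ^ (p - 1) := by
        apply rpow_le_rpow _ (hVlow r hr) (by linarith)
        have : 0 ≤ 1 - B * y := by linarith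
        positivity
      rw [mul_rpow (by positivity) (by linarith), mul_rpow hL.le (by positivity), hpw r hr0] at h1
      refine le_trans ?_ h1
      apply mul_le_mul_of_nonneg_left _ (by positivity)
      have h2 : (1 - B * y) ^ (N : ℝ) ≤ (1 - B * y) ^ (p - 1) :=
        rpow_le_rpow_of_exponent_ge (by linarith) (by linarith [mul_pos hB0 hy]) hNp
      refine le_trans ?_ h2
      have := one_add_mul_self_le_rpow_one_add (s := -(B * y)) (by linarith) hN1
      rw [← sub_eq_add_neg] at this
      linarith
    have hGr := hGe r hr0
    have hGp := hGpos r hr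
    have e1 : r ^ (-γ - 1) = r ^ (-γ) * r⁻¹ := by
      rw [rpow_sub_one hr0.ne']; rfl
    have e2 : r ^ (-γ - 1 - 1) = r ^ (-γ) * (r⁻¹ * r⁻¹) := by
      rw [rpow_sub_one hr0.ne', e1]; ring
    have e3 : r ^ (-γ - δ) = r ^ (-γ) * y := by
      rw [hyd, ← rpow_add hr0]; rfl
    have e4 : r ^ (-γ - δ - 1) = r ^ (-γ) * y * r⁻¹ := by
      rw [rpow_sub_one hr0.ne', e3]; rfl
    have e5 : r ^ (-γ - δ - 1 - 1) = r ^ (-γ) * y * (r⁻¹ * r⁻¹) := by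
      rw [rpow_sub_one hr0.ne', e4]; ring
    have hlapG : G2 r + ((n : ℝ) - 1) / r * G1 r
        = ε * r ^ (-γ) * (r ^ 2)⁻¹ * (-K + A * Kd * y) := by
      simp only [hG1, hG2]
      rw [e1, e2, e4, e5, hK, hKd, hm]
      field_simp
      ring
    have hmain : K * (r ^ 2)⁻¹ * (1 - N * (B * y)) * G r ≤
        (1 + κ) * p * (φ r - G r) ^ (p - 1) * G r := by
      apply mul_le_mul_of_nonneg_right _ hGp.le
      have h1 := mul_le_mul_of_nonneg_left hV (by positivity : 0 ≤ (1 + κ) * p)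
      refine le_trans (le_of_eq ?_) h1
      rw [← hκe]; ring
    refine le_trans ?_ (add_le_add_right hmain _)
    rw [hlapG, hGr]
    have e6 : ε * r ^ (-γ) * (r ^ 2)⁻¹ * (-K + A * Kd * y) +
        K * (r ^ 2)⁻¹ * (1 - N * (B * y)) * (ε * (r ^ (-γ) * (1 - A * y)))
        = ε * r ^ (-γ) * (r ^ 2)⁻¹ * (y * (A * (Kd - K) - K * N * B) + K * N * B * A * y ^ 2) := by
      ring
    rw [e6]
    have : 0 ≤ A * (Kd - K) - K * N * B := by linarith
    positivity
  · intro r hr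
    set M := max r r1 with hM
    have hMr : r ≤ M := le_max_left _ _
    have hMr1 : r1 ≤ M := le_max_right _ _
    have hM0 : 0 < M := by linarith
    have h1 := hGle M hMr1
    have h2 : (2 * M) ^ (-γ) ≤ (r + 1) ^ (-γ) :=
      rpow_le_rpow_of_nonpos (by linarith) (by linarith) (by linarith)
    rw [mul_rpow (by norm_num) hM0.le] at h2
    calc G M ≤ ε * M ^ (-γ) := h1
      _ ≤ b * 2 ^ (-γ) * M ^ (-γ) := by gcongr
      _ = b * (2 ^ (-γ) * M ^ (-γ)) := by ring
      _ ≤ _ := by gcongr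

end helpers

/-- Theorem 1.2(ii): let `n > 10`, `p > p_c`, `α > 0`, `b > 0` and
`γ ∈ (ν+λ₁, (n−2)/2)`. If `v₀` is continuous, nonnegative, with
`v₀(x) ≤ φ_α(|x|) − b(|x|+1)^{−γ}` for all `x`, then every bounded classical solution `v`
with initial data `v₀` satisfies `φ_α(0) − v(0,t) ≥ C e^{−κ(γ)t}` for some `C > 0`. -/
theorem lower_rate_from_below_full_space (n : ℕ) (hn : 10 < n) (p α b γ : ℝ)
    (hp : pc n < p) (hα : 0 < α) (hb : 0 < b)
    (hγ : γ ∈ Set.Ioo (nuExp p + lam1 n p) (((n : ℝ) - 2) / 2))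
    (φ : ℝ → ℝ) (a : ℝ) (hφ : IsSteadyStateA n p α φ a)
    (v₀ : EuclideanSpace ℝ (Fin n) → ℝ) (hv₀cont : Continuous v₀)
    (hv₀nonneg : ∀ x, 0 ≤ v₀ x)
    (hv₀upper : ∀ x : EuclideanSpace ℝ (Fin n),
      v₀ x ≤ φ ‖x‖ - b * (‖x‖ + 1) ^ (-γ))
    (v : EuclideanSpace ℝ (Fin n) → ℝ → ℝ) (hv : IsBddClassicalSol n p v v₀) :
    ∃ C > 0, ∀ t ≥ (0 : ℝ),
      C * Real.exp (-(kappaOf n p γ) * t) ≤ φ 0 - v 0 t := by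
  obtain ⟨hp1, hν, hl, hL, hκ, hκe⟩ := aux_params hn hp hγ
  have hνp : nuExp p * (p - 1) = 2 := by
    have : p - 1 ≠ 0 := by linarith
    rw [nuExp]; field_simp
  obtain ⟨c0, r1, G, G1, G2, hc0, hr1, hG1, hG2, hmax, hGp, hpos, hc, hsub, hinit⟩ :=
    aux_barrier (n := n) (b := b) hp1 hν hνp hl hL hκ hκe hb hφ.a_pos hγ.1 hγ.2 hφ.pos hφ.anti
      hφ.expansion
  have hcmp := aux_compare hn hp1 hφ hκ hc0 hr1 hG1 hG2 hmax (fun r hr => (hGp r hr).le) hpos hc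
    hsub hv (fun x => by
      have h1 := hv₀upper x
      have h2 := hinit ‖x‖ (norm_nonneg x)
      linarith)
  refine ⟨G (max 0 r1), hGp 0 le_rfl, fun t ht => ?_⟩
  have := hcmp 0 t ht
  rw [norm_zero] at this
  linarith
end
end
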